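/- arXiv:2511.18540 — 7 statements merged into one kernel-verified Lean document; each statement's English description precedes it below -/
import Mathlib

section
/- Let L be a finite lattice and fix a chain 0̂ = x_0 < x_1 < ⋯ < x_k = 1̂ containing the minimum and maximum of L. Then for every cover relation b ⋖ c in L one has γ2(b⋖c) = γ2'(b⋖c) ≤ γ1(b⋖c) = γ1'(b⋖c). Moreover, γ1'(b⋖c) = γ2'(b⋖c) holds for all cover relations b ⋖ c if and only if every x_i (0 ≤ i ≤ k) is a left modular element of L. -/
universe u

/-- A join-irreducible element of a finite lattice: an element covering exactly one element. -/
def IsJoinIrred {α : Type u} [Lattice α] (j : α) : Prop := ∃! b : α, b ⋖ j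

/-- A meet-irreducible element of a finite lattice: an element covered by exactly one element. -/
def IsMeetIrred {α : Type u} [Lattice α] (m : α) : Prop := ∃! b : α, m ⋖ b

/-- An element `a` of a lattice is left modular if for all `b < c`,
`(b ⊔ a) ⊓ c = b ⊔ (a ⊓ c)`. -/
def LeftModular {α : Type u} [Lattice α] (a : α) : Prop :=
  ∀ b c : α, b < c → (b ⊔ a) ⊓ c = b ⊔ (a ⊓ c)

/-- Given a chain `⊥ = x 0 < x 1 < ⋯ < x k = ⊤`, for a join-irreducible `j`,
`δ(j) = min {i : j ≤ x i}`. -/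
noncomputable def deltaLab {α : Type u} [Lattice α] (k : ℕ) (x : ℕ → α) (j : α) : ℕ :=
  sInf {i : ℕ | i ≤ k ∧ j ≤ x i}

/-- For a meet-irreducible `m`, `β(m) = max {i : x (i-1) ≤ m}`. -/
noncomputable def betaLab {α : Type u} [Lattice α] (k : ℕ) (x : ℕ → α) (m : α) : ℕ :=
  sSup {i : ℕ | 1 ≤ i ∧ i ≤ k ∧ x (i - 1) ≤ m}

/-- `γ₁(b ⋖ c) = min {δ(j) : j join-irreducible, j ≤ c, j ≰ b}`. -/
noncomputable def gammaOne {α : Type u} [Lattice α] (k : ℕ) (x : ℕ → α) (b c : α) : ℕ :=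
  sInf (deltaLab k x '' {j : α | IsJoinIrred j ∧ j ≤ c ∧ ¬ j ≤ b})

/-- `γ₁'(b ⋖ c) = max {i : c ⊓ x (i-1) ≤ b}`. -/
noncomputable def gammaOne' {α : Type u} [Lattice α] (k : ℕ) (x : ℕ → α) (b c : α) : ℕ :=
  sSup {i : ℕ | 1 ≤ i ∧ i ≤ k ∧ c ⊓ x (i - 1) ≤ b}

/-- `γ₂(b ⋖ c) = max {β(m) : m meet-irreducible, m ≥ b, m ≱ c}`. -/
noncomputable def gammaTwo {α : Type u} [Lattice α] (k : ℕ) (x : ℕ → α) (b c : α) : ℕ :=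
  sSup (betaLab k x '' {m : α | IsMeetIrred m ∧ b ≤ m ∧ ¬ c ≤ m})

/-- `γ₂'(b ⋖ c) = min {i : c ≤ b ⊔ x i}`. -/
noncomputable def gammaTwo' {α : Type u} [Lattice α] (k : ℕ) (x : ℕ → α) (b c : α) : ℕ :=
  sInf {i : ℕ | i ≤ k ∧ c ≤ b ⊔ x i}

section NatExtrema

variable {k : ℕ} {P : ℕ → Prop}

theorem sInf_bounded_le_iff (mono : ∀ i j, i ≤ j → j ≤ k → P i → P j) (hk : P k)
    {i : ℕ} (hi : i ≤ k) : sInf {i | i ≤ k ∧ P i} ≤ i ↔ P i := by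
  constructor
  · intro h
    exact mono _ _ h hi (Nat.sInf_mem (s := {i | i ≤ k ∧ P i}) ⟨k, le_rfl, hk⟩).2
  · exact fun h => Nat.sInf_le ⟨hi, h⟩

theorem sSup_shifted_le : sSup {i | 1 ≤ i ∧ i ≤ k ∧ P (i - 1)} ≤ k :=
  csSup_le' fun _ hi => hi.2.1

theorem lt_sSup_shifted_iff (anti : ∀ i j, i ≤ j → j ≤ k → P j → P i) (h0 : P 0)
    {i : ℕ} (hi : i < k) : i < sSup {i | 1 ≤ i ∧ i ≤ k ∧ P (i - 1)} ↔ P i := by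
  have hbdd : BddAbove {i | 1 ≤ i ∧ i ≤ k ∧ P (i - 1)} := ⟨k, fun _ hi => hi.2.1⟩
  constructor
  · intro h
    obtain ⟨_, hle, hP⟩ := Nat.sSup_mem (s := {i | 1 ≤ i ∧ i ≤ k ∧ P (i - 1)})
      ⟨1, le_rfl, by omega, h0⟩ hbdd
    exact anti _ _ (by omega) (by omega) hP
  · exact fun h => Nat.lt_of_succ_le (le_csSup hbdd ⟨by omega, by omega, h⟩)

theorem eq_of_forall_lt_iff_of_le {m n : ℕ} (hm : m ≤ k) (hn : n ≤ k)
    (h : ∀ i < k, i < m ↔ i < n) : m = n := by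
  apply le_antisymm
  · by_contra! hlt
    exact lt_irrefl n ((h n (by omega)).1 hlt)
  · by_contra! hlt
    exact lt_irrefl m ((h m (by omega)).2 hlt)

end NatExtrema

section Irreducibles

variable {α : Type u} [Lattice α] [Finite α]

theorem exists_isJoinIrred_le_not_le {a b : α} (h : ¬ a ≤ b) :
    ∃ j, IsJoinIrred j ∧ j ≤ a ∧ ¬ j ≤ b := by
  obtain ⟨j, ⟨hja, hjb⟩, hmin⟩ :=
    (Set.toFinite {j | j ≤ a ∧ ¬ j ≤ b}).exists_minimal ⟨a, le_rfl, h⟩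
  have below : ∀ d < j, d ≤ b := by
    intro d hd
    by_contra hdb
    exact hd.not_ge (hmin ⟨hd.le.trans hja, hdb⟩ hd.le)
  have hinf : j ⊓ b < j := inf_lt_left.2 hjb
  obtain ⟨d, -, hd⟩ := exists_le_covBy_of_lt hinf
  refine ⟨j, ⟨d, hd, fun e he => ?_⟩, hja, hjb⟩
  by_contra hne
  exact hjb (he.wcovBy.sup_eq hd.wcovBy hne ▸ sup_le (below e he.lt) (below d hd.lt))

theorem exists_isMeetIrred_ge_not_ge {a b : α} (h : ¬ a ≤ b) :
    ∃ m, IsMeetIrred m ∧ b ≤ m ∧ ¬ a ≤ m := by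
  obtain ⟨m, ⟨hbm, ham⟩, hmax⟩ :=
    (Set.toFinite {m | b ≤ m ∧ ¬ a ≤ m}).exists_maximal ⟨b, le_rfl, h⟩
  have above : ∀ d, m < d → a ≤ d := by
    intro d hd
    by_contra hda
    exact hd.not_ge (hmax ⟨hbm.trans hd.le, hda⟩ hd.le)
  have hsup : m < m ⊔ a := left_lt_sup.2 ham
  obtain ⟨d, hd, -⟩ := exists_covBy_le_of_lt hsup
  refine ⟨m, ⟨d, hd, fun e he => ?_⟩, hbm, ham⟩
  by_contra hne
  exact ham (he.wcovBy.inf_eq hd.wcovBy hne ▸ le_inf (above e he.lt) (above d hd.lt))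

end Irreducibles

theorem chain_le {α : Type u} [Preorder α] {k : ℕ} {x : ℕ → α}
    (hchain : ∀ i : ℕ, i < k → x i < x (i + 1)) :
    ∀ i j, i ≤ j → j ≤ k → x i ≤ x j := by
  intro i j hij
  induction j, hij using Nat.le_induction with
  | base => exact fun _ => le_rfl
  | succ j _ ih => exact fun hj => (ih (by omega)).trans (hchain j (by omega)).le

theorem gammaTwo_le {α : Type u} [Lattice α] {k : ℕ} {x : ℕ → α} {b c : α} :
    gammaTwo k x b c ≤ k := by
  apply csSup_le'
  rintro _ ⟨m, -, rfl⟩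
  exact sSup_shifted_le (P := fun i => x i ≤ m)

section Labels

variable {α : Type u} [Lattice α] [BoundedOrder α] {k : ℕ} {x : ℕ → α} {b c : α}

theorem deltaLab_le_iff (hxk : x k = ⊤) (hx : ∀ i j, i ≤ j → j ≤ k → x i ≤ x j)
    {i : ℕ} (hi : i ≤ k) (j : α) : deltaLab k x j ≤ i ↔ j ≤ x i :=
  sInf_bounded_le_iff (P := fun i => j ≤ x i) (fun _ _ hij hj h => h.trans (hx _ _ hij hj))
    (hxk ▸ le_top) hi

theorem lt_betaLab_iff (hx0 : x 0 = ⊥) (hx : ∀ i j, i ≤ j → j ≤ k → x i ≤ x j)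
    {i : ℕ} (hi : i < k) (m : α) : i < betaLab k x m ↔ x i ≤ m :=
  lt_sSup_shifted_iff (P := fun i => x i ≤ m) (fun _ _ hij hj h => (hx _ _ hij hj).trans h)
    (hx0 ▸ bot_le) hi

theorem gammaTwo'_le_iff (hxk : x k = ⊤) (hx : ∀ i j, i ≤ j → j ≤ k → x i ≤ x j)
    {i : ℕ} (hi : i ≤ k) : gammaTwo' k x b c ≤ i ↔ c ≤ b ⊔ x i :=
  sInf_bounded_le_iff (P := fun i => c ≤ b ⊔ x i)
    (fun _ _ hij hj h => h.trans (sup_le_sup_left (hx _ _ hij hj) b)) (by simp [hxk]) hi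

theorem lt_gammaOne'_iff (hx0 : x 0 = ⊥) (hx : ∀ i j, i ≤ j → j ≤ k → x i ≤ x j)
    {i : ℕ} (hi : i < k) : i < gammaOne' k x b c ↔ c ⊓ x i ≤ b :=
  lt_sSup_shifted_iff (P := fun i => c ⊓ x i ≤ b)
    (fun _ _ hij hj h => (inf_le_inf_left c (hx _ _ hij hj)).trans h) (by simp [hx0]) hi

theorem gammaOne_le_iff [Finite α] (hxk : x k = ⊤) (hx : ∀ i j, i ≤ j → j ≤ k → x i ≤ x j)
    (hcb : ¬ c ≤ b) {i : ℕ} (hi : i ≤ k) : gammaOne k x b c ≤ i ↔ ¬ c ⊓ x i ≤ b := by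
  constructor
  · intro h hle
    obtain ⟨j, ⟨-, hjc, hjb⟩, hj⟩ := Nat.sInf_mem
      (Set.Nonempty.image (deltaLab k x) (exists_isJoinIrred_le_not_le hcb))
    exact hjb ((le_inf hjc ((deltaLab_le_iff hxk hx hi j).1 (hj.trans_le h))).trans hle)
  · intro h
    obtain ⟨j, hj, hjc, hjb⟩ := exists_isJoinIrred_le_not_le h
    obtain ⟨hjc, hji⟩ := le_inf_iff.1 hjc
    have hle : gammaOne k x b c ≤ deltaLab k x j := Nat.sInf_le ⟨j, ⟨hj, hjc, hjb⟩, rfl⟩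
    exact hle.trans ((deltaLab_le_iff hxk hx hi j).2 hji)

theorem lt_gammaTwo_iff [Finite α] (hx0 : x 0 = ⊥) (hx : ∀ i j, i ≤ j → j ≤ k → x i ≤ x j)
    (hcb : ¬ c ≤ b) {i : ℕ} (hi : i < k) : i < gammaTwo k x b c ↔ ¬ c ≤ b ⊔ x i := by
  have hbdd : BddAbove (betaLab k x '' {m : α | IsMeetIrred m ∧ b ≤ m ∧ ¬ c ≤ m}) :=
    (Set.toFinite _).bddAbove
  constructor
  · intro h hle
    obtain ⟨m, ⟨-, hbm, hcm⟩, hm⟩ := Nat.sSup_mem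
      (Set.Nonempty.image (betaLab k x) (exists_isMeetIrred_ge_not_ge hcb)) hbdd
    exact hcm (hle.trans (sup_le hbm ((lt_betaLab_iff hx0 hx hi m).1 (h.trans_eq hm.symm))))
  · intro h
    obtain ⟨m, hm, hbm, hcm⟩ := exists_isMeetIrred_ge_not_ge h
    obtain ⟨hbm, him⟩ := sup_le_iff.1 hbm
    exact ((lt_betaLab_iff hx0 hx hi m).2 him).trans_le
      (le_csSup hbdd ⟨m, ⟨hm, hbm, hcm⟩, rfl⟩)

theorem gammaOne_eq_gammaOne' [Finite α] (hx0 : x 0 = ⊥) (hxk : x k = ⊤)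
    (hx : ∀ i j, i ≤ j → j ≤ k → x i ≤ x j) (hcb : ¬ c ≤ b) :
    gammaOne k x b c = gammaOne' k x b c := by
  refine eq_of_forall_lt_iff_of_le ((gammaOne_le_iff hxk hx hcb le_rfl).2 (by simpa [hxk]))
    (sSup_shifted_le (P := fun i => c ⊓ x i ≤ b)) fun i hi => ?_
  rw [lt_gammaOne'_iff hx0 hx hi, ← not_le, gammaOne_le_iff hxk hx hcb hi.le, not_not]

theorem gammaTwo_eq_gammaTwo' [Finite α] (hx0 : x 0 = ⊥) (hxk : x k = ⊤)
    (hx : ∀ i j, i ≤ j → j ≤ k → x i ≤ x j) (hcb : ¬ c ≤ b) :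
    gammaTwo k x b c = gammaTwo' k x b c := by
  refine eq_of_forall_lt_iff_of_le gammaTwo_le
    ((gammaTwo'_le_iff hxk hx le_rfl).2 (by simp [hxk])) fun i hi => ?_
  rw [lt_gammaTwo_iff hx0 hx hcb hi, ← not_le, gammaTwo'_le_iff hxk hx hi.le]

end Labels

theorem CovBy.le_sup_of_not_inf_le {α : Type u} [Lattice α] {a b c : α} (h : b ⋖ c)
    (hle : ¬ c ⊓ a ≤ b) : c ≤ b ⊔ a := by
  have heq : b ⊔ c ⊓ a = c :=
    (h.eq_or_eq le_sup_left (sup_le h.le inf_le_left)).resolve_left (by simpa using hle)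
  exact heq.ge.trans (sup_le_sup_left inf_le_right b)

theorem leftModular_iff_forall_covBy {α : Type u} [Lattice α] [Finite α] {a : α} :
    LeftModular a ↔ ∀ b c : α, b ⋖ c → c ≤ b ⊔ a → ¬ c ⊓ a ≤ b := by
  constructor
  · intro ha b c hbc hle hinf
    have h := ha b c hbc.lt
    rw [inf_eq_right.2 hle, sup_eq_left.2 (inf_comm c a ▸ hinf)] at h
    exact hbc.lt.ne' h
  · intro ha b c hbc
    by_contra hne
    have hle : b ⊔ (a ⊓ c) ≤ (b ⊔ a) ⊓ c :=
      sup_le (le_inf le_sup_left hbc.le) (inf_le_inf_right c le_sup_right)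
    obtain ⟨q, hq, hqle⟩ := exists_covBy_le_of_lt (lt_of_le_of_ne hle (Ne.symm hne))
    obtain ⟨hqa, hqc⟩ := le_inf_iff.1 hqle
    refine ha _ q hq (hqa.trans (sup_le_sup_right le_sup_left a)) ?_
    exact (le_inf inf_le_right (inf_le_left.trans hqc)).trans le_sup_right

/-- For a finite lattice `L` and a chain `0̂ = x_0 < ⋯ < x_k = 1̂`:
for every cover `b ⋖ c` one has `γ₂ = γ₂' ≤ γ₁ = γ₁'`; moreover `γ₁' = γ₂'` holds on
all covers if and only if every `x i` is left modular. -/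
theorem gamma_labellings (α : Type u) [Lattice α] [Fintype α] [BoundedOrder α]
    (k : ℕ) (x : ℕ → α)
    (hx0 : x 0 = ⊥) (hxk : x k = ⊤)
    (hchain : ∀ i : ℕ, i < k → x i < x (i + 1)) :
    (∀ b c : α, b ⋖ c →
      gammaTwo k x b c = gammaTwo' k x b c ∧
      gammaTwo' k x b c ≤ gammaOne k x b c ∧
      gammaOne k x b c = gammaOne' k x b c) ∧
    ((∀ b c : α, b ⋖ c → gammaOne' k x b c = gammaTwo' k x b c) ↔
      ∀ i : ℕ, i ≤ k → LeftModular (x i)) := by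
  have hx := chain_le hchain
  constructor
  · intro b c hbc
    have hcb := hbc.lt.not_ge
    have hk : gammaOne k x b c ≤ k := (gammaOne_le_iff hxk hx hcb le_rfl).2 (by simpa [hxk])
    exact ⟨gammaTwo_eq_gammaTwo' hx0 hxk hx hcb,
      (gammaTwo'_le_iff hxk hx hk).2
        (hbc.le_sup_of_not_inf_le ((gammaOne_le_iff hxk hx hcb hk).1 le_rfl)),
      gammaOne_eq_gammaOne' hx0 hxk hx hcb⟩
  · simp only [leftModular_iff_forall_covBy]
    constructor
    · intro h i hi b c hbc hle
      rw [← gammaOne_le_iff hxk hx hbc.lt.not_ge hi,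
        gammaOne_eq_gammaOne' hx0 hxk hx hbc.lt.not_ge, h b c hbc]
      exact (gammaTwo'_le_iff hxk hx hi).2 hle
    · intro h b c hbc
      have hcb := hbc.lt.not_ge
      rw [← gammaOne_eq_gammaOne' hx0 hxk hx hcb]
      refine eq_of_forall_lt_iff_of_le ((gammaOne_le_iff hxk hx hcb le_rfl).2 (by simpa [hxk]))
        ((gammaTwo'_le_iff hxk hx le_rfl).2 (by simp [hxk])) fun i hi => not_le.symm.trans
          (Iff.trans (not_congr ?_) not_le)
      rw [gammaOne_le_iff hxk hx hcb hi.le, gammaTwo'_le_iff hxk hx hi.le]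
      exact ⟨hbc.le_sup_of_not_inf_le, h i hi.le b c hbc⟩
end

section
/- Let C be a convex subset of a finite lattice L. Then the heart H(C) is a convex subset of L, and H(C) = {a ∈ C : for all b ∈ C, a ∨ b ∈ C and a ∧ b ∈ C}. -/
universe u

/-- The heart `H(C)` of a subset `C` of a lattice: the set of elements of `C` that are
below every maximal element of `C` and above every minimal element of `C`. -/
def heart {α : Type u} [Lattice α] (C : Set α) : Set α :=
  {a : α | a ∈ C ∧ (∀ M : α, Maximal (· ∈ C) M → a ≤ M) ∧
    (∀ m : α, Minimal (· ∈ C) m → m ≤ a)}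

/-- For a convex subset `C` of a finite lattice, the heart `H(C)` is convex, and
`H(C) = {a ∈ C : ∀ b ∈ C, a ⊔ b ∈ C ∧ a ⊓ b ∈ C}`. -/
theorem heart_ordConnected_and_eq (α : Type u) [Lattice α] [Fintype α] [Nonempty α]
    (C : Set α) (hC : C.OrdConnected) :
    (heart C).OrdConnected ∧
    heart C = {a : α | a ∈ C ∧ ∀ b ∈ C, a ⊔ b ∈ C ∧ a ⊓ b ∈ C} := by
  refine ⟨⟨?_⟩, ?_⟩
  · rintro x ⟨hx, -, hxm⟩ y ⟨hy, hyM, -⟩ z ⟨hxz, hzy⟩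
    exact ⟨hC.out hx hy ⟨hxz, hzy⟩, fun M hM => hzy.trans (hyM M hM),
      fun m hm => (hxm m hm).trans hxz⟩
  · ext a
    refine ⟨fun ⟨ha, haM, ham⟩ => ⟨ha, fun b hb => ⟨?_, ?_⟩⟩,
      fun ⟨ha, h⟩ => ⟨ha, fun M hM => ?_, fun m hm => ?_⟩⟩
    · obtain ⟨M, hbM, hM⟩ := C.toFinite.exists_le_maximal hb
      exact hC.out ha hM.prop ⟨le_sup_left, sup_le (haM M hM) hbM⟩
    · obtain ⟨m, hmb, hm⟩ := C.toFinite.exists_le_minimal hb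
      exact hC.out hm.prop ha ⟨le_inf (ham m hm) hmb, inf_le_left⟩
    · exact le_sup_left.trans (hM.le_of_ge (h M hM.prop).1 le_sup_right)
    · exact (hm.le_of_le (h m hm.prop).2 inf_le_right).trans inf_le_left
end

section
/- Let L be a finite lattice and C a nonempty convex subset of L. If C intersects the spine of L then ℓ(L[C]) = ℓ(L) + 1, and if C does not intersect the spine of L then ℓ(L[C]) = ℓ(L). -/
universe u

/-- The length of a finite poset: the maximum `n` such that there is a chain
`x_0 < x_1 < ⋯ < x_n`. -/
noncomputable def latLen (β : Type u) [Preorder β] : ℕ :=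
  sSup {n : ℕ | ∃ f : Fin (n + 1) → β, StrictMono f}

/-- The spine of a finite poset: the set of elements lying on some chain of
maximum length. -/
noncomputable def spine (β : Type u) [Preorder β] : Set β :=
  {a : β | ∃ f : Fin (latLen β + 1) → β, StrictMono f ∧ a ∈ Set.range f}

/-- The order ideal `I_L(C)` generated by a subset `C`. -/
def lowerIdeal {α : Type u} [Preorder α] (C : Set α) : Set α :=
  {y : α | ∃ x ∈ C, y ≤ x}

/-- The underlying subset of `L × {0,1}` of Day's doubling `L[C]`:
`(I_L(C) × {0}) ∪ (((L \ I_L(C)) ∪ C) × {1})`. -/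
def doublingSet {α : Type u} [Preorder α] (C : Set α) : Set (α × Bool) :=
  {p : α × Bool | (p.2 = false ∧ p.1 ∈ lowerIdeal C) ∨
    (p.2 = true ∧ (p.1 ∉ lowerIdeal C ∨ p.1 ∈ C))}

/-- Day's doubling `L[C]`, as a subposet of the product `L × {0,1}` where `0 < 1`. -/
abbrev Doubling {α : Type u} [Preorder α] (C : Set α) : Type u :=
  {p : α × Bool // p ∈ doublingSet C}

section Length

variable {β : Type u} [Preorder β]

theorem bddAbove_chain_lengths [Finite β] :
    BddAbove {n : ℕ | ∃ f : Fin (n + 1) → β, StrictMono f} := by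
  refine ⟨Nat.card β, ?_⟩
  rintro n ⟨f, hf⟩
  have h := Nat.card_le_card_of_injective f hf.injective
  simp only [Nat.card_fin] at h
  omega

theorem le_latLen [Finite β] {n : ℕ} {f : Fin (n + 1) → β} (hf : StrictMono f) :
    n ≤ latLen β :=
  le_csSup bddAbove_chain_lengths ⟨f, hf⟩

theorem exists_strictMono_latLen (β : Type u) [Preorder β] [Finite β] [Nonempty β] :
    ∃ f : Fin (latLen β + 1) → β, StrictMono f :=
  Nat.sSup_mem (s := {n : ℕ | ∃ f : Fin (n + 1) → β, StrictMono f})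
    ⟨0, fun _ => Classical.arbitrary β, Subsingleton.strictMono (α := Fin 1) _⟩ bddAbove_chain_lengths

end Length

section Doubling

variable {α : Type u} [PartialOrder α] {C : Set α}

/-- A strictly monotone section of the projection `L[C] → L`. -/
theorem exists_strictMono_to_doubling (C : Set α) : ∃ s : α → Doubling C, StrictMono s := by
  classical
  refine ⟨fun x => if hx : x ∈ lowerIdeal C then ⟨(x, false), Or.inl ⟨rfl, hx⟩⟩
    else ⟨(x, true), Or.inr ⟨rfl, Or.inl hx⟩⟩, ?_⟩
  intro x y hxy
  by_cases hy : y ∈ lowerIdeal C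
  · have hx : x ∈ lowerIdeal C := by
      obtain ⟨c, hc, hyc⟩ := hy
      exact ⟨c, hc, hxy.le.trans hyc⟩
    simpa [hx, hy] using Subtype.mk_lt_mk.mpr (Prod.mk_lt_mk.mpr (Or.inl ⟨hxy, le_rfl⟩))
  · by_cases hx : x ∈ lowerIdeal C
    · simpa [hx, hy] using
        Subtype.mk_lt_mk.mpr (Prod.mk_lt_mk.mpr (Or.inl ⟨hxy, Bool.false_le true⟩))
    · simpa [hx, hy] using Subtype.mk_lt_mk.mpr (Prod.mk_lt_mk.mpr (Or.inl ⟨hxy, le_rfl⟩))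

/-- A chain of `L` that meets a convex set `C` lifts to a chain of `L[C]` with one more element. -/
theorem exists_strictMono_doubling_succ (hC : C.OrdConnected) {n : ℕ} {f : Fin (n + 1) → α}
    (hf : StrictMono f) {i : Fin (n + 1)} (hi : f i ∈ C) :
    ∃ g : Fin (n + 1 + 1) → Doubling C, StrictMono g := by
  have mem (j : Fin (n + 1 + 1)) :
      (f (i.predAbove j), decide (i.castSucc < j)) ∈ doublingSet C := by
    by_cases hj : i.castSucc < j
    · refine Or.inr ⟨by simpa using hj, ?_⟩
      by_cases hI : f (i.predAbove j) ∈ lowerIdeal C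
      · obtain ⟨c, hc, hle⟩ := hI
        refine Or.inr (hC.out hi hc ⟨hf.monotone ?_, hle⟩)
        rw [Fin.predAbove_of_castSucc_lt _ _ hj, Fin.le_pred_iff]
        simpa [Fin.lt_def, Fin.le_def] using hj
      · exact Or.inl hI
    · refine Or.inl ⟨by simpa using hj, f i, hi, hf.monotone ?_⟩
      rw [Fin.predAbove_of_le_castSucc _ _ (not_lt.mp hj)]
      simpa [Fin.lt_def, Fin.le_def] using hj
  refine ⟨fun j => ⟨_, mem j⟩, fun j k hjk => ?_⟩
  have hle : i.predAbove j ≤ i.predAbove k := Fin.predAbove_right_monotone i hjk.le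
  have hsnd : decide (i.castSucc < j) ≤ decide (i.castSucc < k) := by
    simpa [Bool.le_iff_imp] using fun h : i.castSucc < j => h.trans hjk
  refine Subtype.mk_lt_mk.mpr (lt_of_le_of_ne ⟨hf.monotone hle, hsnd⟩ fun h => ?_)
  obtain ⟨h₁, h₂⟩ := Prod.mk.inj h
  have h₁ := congrArg Fin.val (hf.injective h₁)
  have h₂ := decide_eq_decide.mp h₂
  have hjk' := Fin.lt_def.mp hjk
  by_cases hj : i.castSucc < j
  · rw [Fin.predAbove_of_castSucc_lt _ _ hj, Fin.predAbove_of_castSucc_lt _ _ (h₂.mp hj)] at h₁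
    have := Fin.lt_def.mp hj
    simp only [Fin.val_pred, Fin.val_castSucc] at h₁ this
    omega
  · have hk : ¬ i.castSucc < k := fun h => hj (h₂.mpr h)
    rw [Fin.predAbove_of_le_castSucc _ _ (not_lt.mp hj),
      Fin.predAbove_of_le_castSucc _ _ (not_lt.mp hk)] at h₁
    simp only [Fin.coe_castPred] at h₁
    omega

theorem snd_of_lt_of_fst_eq {p q : α × Bool} (h : p < q) (hfst : p.1 = q.1) :
    p.2 = false ∧ q.2 = true := by
  obtain ⟨x, a⟩ := p
  obtain ⟨y, b⟩ := q
  obtain rfl : x = y := hfst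
  simpa [Bool.lt_iff] using h

/-- Dropping the upper one of two elements of a chain of `L[C]` with the same projection leaves a
chain that projects injectively to `L`. -/
theorem strictMono_fst_comp_succAbove {n : ℕ} {f : Fin (n + 1) → Doubling C} (hf : StrictMono f)
    {p q : Fin (n + 1)} (hpq : p < q) (h : (f p).1.1 = (f q).1.1) :
    StrictMono fun i : Fin n => (f (q.succAbove i)).1.1 := by
  intro i j hij
  have hlt := q.strictMono_succAbove hij
  have hne := q.succAbove_ne j
  beta_reduce
  generalize q.succAbove i = a at *
  generalize q.succAbove j = b at *
  refine lt_of_le_of_ne (hf hlt).le.1 fun heq => hne (hf.injective ?_)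
  obtain ⟨hp, hq⟩ := snd_of_lt_of_fst_eq (hf hpq) h
  obtain ⟨ha, hb⟩ := snd_of_lt_of_fst_eq (hf hlt) heq
  have lt_of_snd {c d : Fin (n + 1)} (hc : (f c).1.2 = false) (hd : (f d).1.2 = true) :
      c < d := by
    by_contra hcd
    have := (hf.monotone (not_lt.mp hcd)).2
    rw [hc, hd] at this
    exact absurd this (by decide)
  have h₁ : (f p).1.1 ≤ (f b).1.1 := (hf (lt_of_snd hp hb)).le.1
  have h₂ : (f a).1.1 ≤ (f q).1.1 := (hf (lt_of_snd ha hq)).le.1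
  exact Subtype.ext (Prod.ext (le_antisymm (heq ▸ h₂) (h ▸ h₁)) (hb.trans hq.symm))

/-- A chain of `L[C]` either projects to a chain of the same length in `L`, or to a chain of `L`
that is shorter by one and meets `C`. -/
theorem strictMono_fst_or_exists {n : ℕ} {f : Fin (n + 1) → Doubling C} (hf : StrictMono f) :
    (StrictMono fun i => (f i).1.1) ∨
      ∃ g : Fin n → α, StrictMono g ∧ ∃ i, g i ∈ C := by
  by_cases hinj : ∃ p q, p < q ∧ (f p).1.1 = (f q).1.1
  · obtain ⟨p, q, hpq, h⟩ := hinj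
    refine Or.inr ⟨_, strictMono_fst_comp_succAbove hf hpq h, ?_⟩
    obtain ⟨i, hi⟩ := Fin.exists_succAbove_eq hpq.ne
    refine ⟨i, ?_⟩
    obtain ⟨hp, hq⟩ := snd_of_lt_of_fst_eq (hf hpq) h
    have hpI : (f p).1.1 ∈ lowerIdeal C := by
      rcases (f p).2 with h' | h'
      · exact h'.2
      · simp [hp] at h'
    rcases (f q).2 with h' | h'
    · simp [hq] at h'
    · simpa only [hi, h] using h'.2.resolve_left fun hn => hn (h ▸ hpI)
  · push Not at hinj
    exact Or.inl fun a b hab => lt_of_le_of_ne (hf hab).le.1 (hinj a b hab)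

theorem latLen_le_latLen_doubling [Finite α] [Nonempty α] (C : Set α) :
    latLen α ≤ latLen (Doubling C) := by
  obtain ⟨s, hs⟩ := exists_strictMono_to_doubling C
  obtain ⟨f, hf⟩ := exists_strictMono_latLen α
  exact le_latLen (hs.comp hf)

theorem latLen_doubling_le [Finite α] [Nonempty α] (C : Set α) :
    latLen (Doubling C) ≤ latLen α ∨
      latLen (Doubling C) = latLen α + 1 ∧ (C ∩ spine α).Nonempty := by
  obtain ⟨s, -⟩ := exists_strictMono_to_doubling C
  have : Nonempty (Doubling C) := Nonempty.map s ‹_›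
  obtain ⟨f, hf⟩ := exists_strictMono_latLen (Doubling C)
  generalize latLen (Doubling C) = n at *
  rcases strictMono_fst_or_exists hf with h | ⟨g, hg, i, hi⟩
  · exact Or.inl (le_latLen h)
  · obtain _ | n := n
    · exact i.elim0
    · rcases (le_latLen hg).lt_or_eq with h | rfl
      · exact Or.inl h
      · exact Or.inr ⟨rfl, g i, hi, g, hg, i, rfl⟩

end Doubling

/-- If a nonempty convex subset `C` of a finite lattice `L` intersects the spine of `L`
then `ℓ(L[C]) = ℓ(L) + 1`; if it does not, then `ℓ(L[C]) = ℓ(L)`. -/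
theorem length_doubling (α : Type u) [Lattice α] [Fintype α] [Nonempty α]
    (C : Set α) (hne : C.Nonempty) (hconv : C.OrdConnected) :
    ((C ∩ spine α).Nonempty → latLen (Doubling C) = latLen α + 1) ∧
    (C ∩ spine α = ∅ → latLen (Doubling C) = latLen α) := by
  refine ⟨?_, fun h => ?_⟩
  · rintro ⟨_, hc, f, hf, i, rfl⟩
    obtain ⟨g, hg⟩ := exists_strictMono_doubling_succ hconv hf hc
    have hle := le_latLen hg
    rcases latLen_doubling_le C with h | h
    · omega
    · exact h.1
  · refine le_antisymm ((latLen_doubling_le C).resolve_right fun h' => ?_)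
      (latLen_le_latLen_doubling C)
    exact h'.2.ne_empty h
end

section
/- Let L be a finite lattice and C a nonempty convex subset of L. An element of the form (a,0) of the doubling L[C] is left modular in L[C] if and only if a is left modular in L and a is below every maximal element of C. An element of the form (a,1) of L[C] is left modular in L[C] if and only if a is left modular in L and a is above every minimal element of C. Consequently, for a ∈ C, both (a,0) and (a,1) are left modular in L[C] if and only if a is left modular in L and a ∈ H(C). -/
universe u v

theorem mem_doublingSet_false {α : Type u} [Preorder α] {C : Set α} {a : α}
    (h : a ∈ lowerIdeal C) : ((a, false) : α × Bool) ∈ doublingSet C :=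
  Or.inl ⟨rfl, h⟩

theorem mem_doublingSet_true {α : Type u} [Preorder α] {C : Set α} {a : α}
    (h : a ∉ lowerIdeal C ∨ a ∈ C) : ((a, true) : α × Bool) ∈ doublingSet C :=
  Or.inr ⟨rfl, h⟩

theorem self_mem_lowerIdeal {α : Type u} [Preorder α] {C : Set α} {a : α}
    (h : a ∈ C) : a ∈ lowerIdeal C :=
  ⟨a, h, le_rfl⟩

/-- The order filter `(L \ I_L(C)) ∪ C`, over which the doubling `L[C]` has level-one elements. -/
def upperPart {α : Type u} [Preorder α] (C : Set α) : Set α :=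
  {x : α | x ∉ lowerIdeal C ∨ x ∈ C}

section Preorder

variable {α : Type u} [Preorder α] {C : Set α}

theorem isLowerSet_lowerIdeal : IsLowerSet (lowerIdeal C) :=
  fun _ _ hyx ⟨c, hc, hxc⟩ => ⟨c, hc, hyx.trans hxc⟩

theorem isUpperSet_upperPart [C.OrdConnected] : IsUpperSet (upperPart C) := by
  rintro x y hxy (hx | hx)
  · exact Or.inl fun hy => hx (isLowerSet_lowerIdeal hxy hy)
  · by_cases hy : y ∈ lowerIdeal C
    · obtain ⟨c, hc, hyc⟩ := hy
      exact Or.inr (Set.OrdConnected.out ‹_› hx hc ⟨hxy, hyc⟩)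
    · exact Or.inl hy

theorem mem_of_mem_lowerIdeal_of_mem_upperPart {x : α} (hI : x ∈ lowerIdeal C)
    (hU : x ∈ upperPart C) : x ∈ C :=
  hU.resolve_left (not_not_intro hI)

theorem mem_upperPart_of_mem {x : α} (hx : x ∈ C) : x ∈ upperPart C :=
  Or.inr hx

namespace Doubling

theorem fst_mem_lowerIdeal {p : Doubling C} (hp : p.1.2 = false) : p.1.1 ∈ lowerIdeal C := by
  have h := p.2
  simp only [doublingSet, Set.mem_ofPred_eq, hp] at h
  simpa using h

theorem fst_mem_upperPart {p : Doubling C} (hp : p.1.2 = true) : p.1.1 ∈ upperPart C := by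
  have h := p.2
  simp only [doublingSet, Set.mem_ofPred_eq, hp] at h
  simpa [upperPart] using h

theorem le_iff {p q : Doubling C} :
    p ≤ q ↔ p.1.1 ≤ q.1.1 ∧ (p.1.2 = true → q.1.2 = true) :=
  Iff.rfl

end Doubling

end Preorder

namespace Doubling

variable {α : Type u} [Lattice α] {C : Set α}

open Classical in
/-- The lattice structure on the doubling of a convex set. -/
noncomputable instance lattice [C.OrdConnected] : Lattice (Doubling C) where
  sup p q := ⟨(p.1.1 ⊔ q.1.1, p.1.2 || q.1.2 || decide (p.1.1 ⊔ q.1.1 ∉ lowerIdeal C)), by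
    by_cases hI : p.1.1 ⊔ q.1.1 ∈ lowerIdeal C
    · cases hp : p.1.2
      · cases hq : q.1.2
        · simpa [hI] using mem_doublingSet_false hI
        · simpa using mem_doublingSet_true
            (isUpperSet_upperPart le_sup_right (fst_mem_upperPart hq))
      · simpa using mem_doublingSet_true
          (isUpperSet_upperPart le_sup_left (fst_mem_upperPart hp))
    · simpa [hI] using mem_doublingSet_true (Or.inl hI)⟩
  le_sup_left p q := le_iff.2 ⟨le_sup_left, fun h => by simp [h]⟩
  le_sup_right p q := le_iff.2 ⟨le_sup_right, fun h => by simp [h]⟩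
  sup_le p q r hp hq := by
    refine le_iff.2 ⟨sup_le (le_iff.1 hp).1 (le_iff.1 hq).1, fun h => ?_⟩
    simp only [Bool.or_eq_true, decide_eq_true_eq] at h
    rcases h with (h | h) | h
    · exact (le_iff.1 hp).2 h
    · exact (le_iff.1 hq).2 h
    · by_contra hr
      exact h (isLowerSet_lowerIdeal (sup_le (le_iff.1 hp).1 (le_iff.1 hq).1)
        (fst_mem_lowerIdeal (Bool.eq_false_of_not_eq_true hr)))
  inf p q := ⟨(p.1.1 ⊓ q.1.1, p.1.2 && q.1.2 && decide (p.1.1 ⊓ q.1.1 ∈ upperPart C)), by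
    by_cases hU : p.1.1 ⊓ q.1.1 ∈ upperPart C
    · cases hp : p.1.2
      · simpa using mem_doublingSet_false
          (isLowerSet_lowerIdeal inf_le_left (fst_mem_lowerIdeal hp))
      · cases hq : q.1.2
        · simpa using mem_doublingSet_false
            (isLowerSet_lowerIdeal inf_le_right (fst_mem_lowerIdeal hq))
        · simpa [hU] using mem_doublingSet_true hU
    · simpa [hU] using mem_doublingSet_false (not_not.1 fun h => hU (Or.inl h))⟩
  inf_le_left p q := le_iff.2 ⟨inf_le_left, fun h => by simp_all⟩
  inf_le_right p q := le_iff.2 ⟨inf_le_right, fun h => by simp_all⟩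
  le_inf p q r hq hr := by
    refine le_iff.2 ⟨le_inf (le_iff.1 hq).1 (le_iff.1 hr).1, fun h => ?_⟩
    simp only [Bool.and_eq_true, decide_eq_true_eq]
    exact ⟨⟨(le_iff.1 hq).2 h, (le_iff.1 hr).2 h⟩, isUpperSet_upperPart
      (le_inf (le_iff.1 hq).1 (le_iff.1 hr).1) (fst_mem_upperPart h)⟩

section Operations

variable [C.OrdConnected] (p q : Doubling C)

theorem fst_sup : (p ⊔ q).1.1 = p.1.1 ⊔ q.1.1 := rfl

theorem fst_inf : (p ⊓ q).1.1 = p.1.1 ⊓ q.1.1 := rfl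

open Classical in
theorem snd_sup : (p ⊔ q).1.2 = true ↔
    (p.1.2 = true ∨ q.1.2 = true) ∨ p.1.1 ⊔ q.1.1 ∉ lowerIdeal C := by
  change (_ || _ || decide _) = true ↔ _
  simp only [Bool.or_eq_true, decide_eq_true_eq]

open Classical in
theorem snd_inf : (p ⊓ q).1.2 = true ↔
    (p.1.2 = true ∧ q.1.2 = true) ∧ p.1.1 ⊓ q.1.1 ∈ upperPart C := by
  change (_ && _ && decide _) = true ↔ _
  simp only [Bool.and_eq_true, decide_eq_true_eq]

end Operations

theorem ext_of_mem {p q : Doubling C} (h₁ : p.1.1 = q.1.1)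
    (h₂ : p.1.1 ∈ C → (p.1.2 = true ↔ q.1.2 = true)) : p = q := by
  refine Subtype.ext (Prod.ext h₁ ?_)
  by_cases hC : p.1.1 ∈ C
  · exact Bool.eq_iff_iff.2 (h₂ hC)
  · cases hp : p.1.2 <;> cases hq : q.1.2
    · rfl
    · exact absurd (mem_of_mem_lowerIdeal_of_mem_upperPart (fst_mem_lowerIdeal hp)
        (h₁ ▸ fst_mem_upperPart hq)) hC
    · exact absurd (mem_of_mem_lowerIdeal_of_mem_upperPart (h₁ ▸ fst_mem_lowerIdeal hq)
        (fst_mem_upperPart hp)) hC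
    · rfl

theorem exists_fst_eq (x : α) : ∃ p : Doubling C, p.1.1 = x := by
  by_cases hx : x ∈ lowerIdeal C
  · exact ⟨⟨_, mem_doublingSet_false hx⟩, rfl⟩
  · exact ⟨⟨_, mem_doublingSet_true (Or.inl hx)⟩, rfl⟩

end Doubling

theorem LeftModular.sup_inf_eq {α : Type u} [Lattice α] {a b c : α} (ha : LeftModular a)
    (hbc : b ≤ c) : (b ⊔ a) ⊓ c = b ⊔ (a ⊓ c) := by
  rcases hbc.eq_or_lt with rfl | h
  · rw [inf_eq_right.2 le_sup_left, sup_eq_left.2 inf_le_right]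
  · exact ha b c h

theorem LeftModular.map_orderIso {α : Type u} {β : Type v} [Lattice α] [Lattice β]
    (e : α ≃o β) {a : α} (ha : LeftModular a) : LeftModular (e a) := by
  intro b c hbc
  have h := congrArg e (ha (e.symm b) (e.symm c) (e.symm.lt_iff_lt.2 hbc))
  simpa using h

theorem leftModular_orderIso_iff {α : Type u} {β : Type v} [Lattice α] [Lattice β]
    (e : α ≃o β) {a : α} : LeftModular (e a) ↔ LeftModular a :=
  ⟨fun h => by simpa using h.map_orderIso e.symm, fun h => h.map_orderIso e⟩

namespace Doubling

variable {α : Type u} [Lattice α] {C : Set α} [C.OrdConnected]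

theorem leftModular_fst {p : Doubling C} (hp : LeftModular p) : LeftModular p.1.1 := by
  intro b c hbc
  obtain ⟨q, rfl⟩ := exists_fst_eq (C := C) b
  obtain ⟨r, rfl⟩ := exists_fst_eq (C := C) c
  have h := congrArg (fun s : Doubling C => s.1.1) (hp.sup_inf_eq (le_sup_left : q ≤ q ⊔ r))
  simpa only [fst_sup, fst_inf, sup_eq_right.2 hbc.le] using h

theorem leftModular_false_iff [Finite α] {a : α} (h : a ∈ lowerIdeal C) :
    LeftModular (⟨(a, false), mem_doublingSet_false h⟩ : Doubling C) ↔
      LeftModular a ∧ ∀ z : α, Maximal (· ∈ C) z → a ≤ z := by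
  refine ⟨fun hp => ⟨leftModular_fst hp, fun z hz => ?_⟩, fun ⟨ha, hmax⟩ b c hbc => ?_⟩
  · have hzU := mem_upperPart_of_mem hz.prop
    have hzI := self_mem_lowerIdeal hz.prop
    let b : Doubling C := ⟨(z, false), mem_doublingSet_false hzI⟩
    let c : Doubling C := ⟨(z, true), mem_doublingSet_true hzU⟩
    have hbc : b ≤ c := le_iff.2 ⟨le_rfl, fun _ => rfl⟩
    have key := congrArg (fun s : Doubling C => s.1.2 = true) (hp.sup_inf_eq hbc)
    simp only [snd_sup, snd_inf, fst_sup, fst_inf, b, c] at key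
    have hI : z ⊔ a ∈ lowerIdeal C := by
      by_contra hI
      simp [hI, hzU, hzI] at key
    obtain ⟨c, hc, hzc⟩ := hI
    exact (le_sup_right.trans hzc).trans (hz.le_of_ge hc (le_sup_left.trans hzc))
  · have hw := ha.sup_inf_eq (le_iff.1 hbc.le).1
    refine ext_of_mem hw fun hC => ?_
    have hC' : b.1.1 ⊔ (a ⊓ c.1.1) ∈ C := hw ▸ hC
    obtain ⟨z, hwz, hz⟩ := (Set.toFinite C).exists_le_maximal hC'
    have hI : b.1.1 ⊔ a ∈ lowerIdeal C :=
      ⟨z, hz.prop, sup_le (le_sup_left.trans hwz) (hmax z hz)⟩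
    have hU : (b.1.1 ⊔ a) ⊓ c.1.1 ∈ upperPart C := mem_upperPart_of_mem hC
    have hle := (le_iff.1 hbc.le).2
    simp only [snd_sup, snd_inf, fst_sup, fst_inf]
    simp only [hI, hU, self_mem_lowerIdeal hC']
    simpa using hle

theorem leftModular_true_iff [Finite α] {a : α} (h : a ∉ lowerIdeal C ∨ a ∈ C) :
    LeftModular (⟨(a, true), mem_doublingSet_true h⟩ : Doubling C) ↔
      LeftModular a ∧ ∀ z : α, Minimal (· ∈ C) z → z ≤ a := by
  refine ⟨fun hp => ⟨leftModular_fst hp, fun z hz => ?_⟩, fun ⟨ha, hmin⟩ b c hbc => ?_⟩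
  · have hzU := mem_upperPart_of_mem hz.prop
    have hzI := self_mem_lowerIdeal hz.prop
    let b : Doubling C := ⟨(z, false), mem_doublingSet_false hzI⟩
    let c : Doubling C := ⟨(z, true), mem_doublingSet_true hzU⟩
    have hbc : b ≤ c := le_iff.2 ⟨le_rfl, fun _ => rfl⟩
    have key := congrArg (fun s : Doubling C => s.1.2 = true) (hp.sup_inf_eq hbc)
    simp only [snd_sup, snd_inf, fst_sup, fst_inf, b, c] at key
    have hU : a ⊓ z ∈ upperPart C := by
      by_contra hU
      simp [hU, hzU, hzI] at key
    have hC : a ⊓ z ∈ C :=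
      mem_of_mem_lowerIdeal_of_mem_upperPart (isLowerSet_lowerIdeal inf_le_right hzI) hU
    exact (hz.le_of_le hC inf_le_right).trans inf_le_left
  · have hw := ha.sup_inf_eq (le_iff.1 hbc.le).1
    refine ext_of_mem hw fun hC => ?_
    have hC' : b.1.1 ⊔ (a ⊓ c.1.1) ∈ C := hw ▸ hC
    obtain ⟨z, hzw, hz⟩ := (Set.toFinite C).exists_le_minimal hC
    have hU' : a ⊓ c.1.1 ∈ upperPart C :=
      isUpperSet_upperPart (le_inf (hmin z hz) (hzw.trans inf_le_right))
        (mem_upperPart_of_mem hz.prop)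
    have hU : (b.1.1 ⊔ a) ⊓ c.1.1 ∈ upperPart C := mem_upperPart_of_mem hC
    have hle := (le_iff.1 hbc.le).2
    simp only [snd_sup, snd_inf, fst_sup, fst_inf]
    simp only [hU, hU', self_mem_lowerIdeal hC']
    simpa using hle

end Doubling

/-- Characterization of the left modular elements of the doubling `L[C]` (realized as any
lattice `M` order-isomorphic to the doubling): `(a,0)` is left modular in `L[C]` iff `a` is
left modular in `L` and below every maximal element of `C`; `(a,1)` is left modular in
`L[C]` iff `a` is left modular in `L` and above every minimal element of `C`; and for
`a ∈ C`, both `(a,0)` and `(a,1)` are left modular in `L[C]` iff `a` is left modular in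
`L` and `a ∈ H(C)`. -/
theorem leftModular_doubling (α : Type u) [Lattice α] [Fintype α] [Nonempty α]
    (C : Set α) (hne : C.Nonempty) (hconv : C.OrdConnected)
    (M : Type v) [Lattice M] (e : M ≃o Doubling C) :
    (∀ (a : α) (h : a ∈ lowerIdeal C),
      LeftModular (e.symm ⟨(a, false), mem_doublingSet_false h⟩) ↔
        (LeftModular a ∧ ∀ z : α, Maximal (· ∈ C) z → a ≤ z)) ∧
    (∀ (a : α) (h : a ∉ lowerIdeal C ∨ a ∈ C),
      LeftModular (e.symm ⟨(a, true), mem_doublingSet_true h⟩) ↔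
        (LeftModular a ∧ ∀ z : α, Minimal (· ∈ C) z → z ≤ a)) ∧
    (∀ (a : α) (h : a ∈ C),
      (LeftModular (e.symm ⟨(a, false), mem_doublingSet_false (self_mem_lowerIdeal h)⟩) ∧
        LeftModular (e.symm ⟨(a, true), mem_doublingSet_true (Or.inr h)⟩)) ↔
        (LeftModular a ∧ a ∈ heart C)) := by
  have h₀ : ∀ (a : α) (h : a ∈ lowerIdeal C),
      LeftModular (e.symm ⟨(a, false), mem_doublingSet_false h⟩) ↔
        (LeftModular a ∧ ∀ z : α, Maximal (· ∈ C) z → a ≤ z) := fun a h =>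
    (leftModular_orderIso_iff e.symm).trans (Doubling.leftModular_false_iff h)
  have h₁ : ∀ (a : α) (h : a ∉ lowerIdeal C ∨ a ∈ C),
      LeftModular (e.symm ⟨(a, true), mem_doublingSet_true h⟩) ↔
        (LeftModular a ∧ ∀ z : α, Minimal (· ∈ C) z → z ≤ a) := fun a h =>
    (leftModular_orderIso_iff e.symm).trans (Doubling.leftModular_true_iff h)
  refine ⟨h₀, h₁, fun a h => ?_⟩
  rw [h₀ a (self_mem_lowerIdeal h), h₁ a (Or.inr h)]
  exact ⟨fun ⟨⟨ha, hmax⟩, _, hmin⟩ => ⟨ha, h, hmax, hmin⟩,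
    fun ⟨ha, _, hmax, hmin⟩ => ⟨⟨ha, hmax⟩, ha, hmin⟩⟩
end

section
/- Let L be a finite lattice and C a nonempty convex subset of L. Suppose there exists a ∈ H(C) that lies on a maximal chain x_0 ⋖ x_1 ⋖ ⋯ ⋖ x_l = a ⋖ ⋯ ⋖ x_n of L all of whose elements are left modular. Then the maximal chain (x_0,0) ⋖ ⋯ ⋖ (x_{l−1},0) ⋖ (a,0) ⋖ (a,1) ⋖ (x_{l+1},1) ⋖ ⋯ ⋖ (x_n,1) of the doubling L[C] consists of left modular elements of L[C]; in particular, L[C] is left modular. -/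
universe u v

/-- A lattice is left modular if it has a maximal chain all of whose elements
are left modular. -/
def IsLeftModularLattice (β : Type u) [Lattice β] : Prop :=
  ∃ s : Set β, IsMaxChain (· ≤ ·) s ∧ ∀ a ∈ s, LeftModular a

section DoublingLattice

variable {α : Type u} [Lattice α] {C : Set α} {M : Type v} [Lattice M]

theorem mem_doublingSet_false_s8 {y : α} : (y, false) ∈ doublingSet C ↔ y ∈ lowerIdeal C := by
  simp [doublingSet]

theorem mem_doublingSet_true_s8 {y : α} :
    (y, true) ∈ doublingSet C ↔ (y ∈ lowerIdeal C → y ∈ C) := by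
  simp [doublingSet, imp_iff_not_or]

theorem mem_lowerIdeal_of_le {y z : α} (hz : z ∈ lowerIdeal C) (hyz : y ≤ z) :
    y ∈ lowerIdeal C := by
  obtain ⟨c, hc, hzc⟩ := hz
  exact ⟨c, hc, hyz.trans hzc⟩

theorem mem_of_le_of_mem_lowerIdeal (hconv : C.OrdConnected) {y z : α} (hy : y ∈ C)
    (hyz : y ≤ z) (hz : z ∈ lowerIdeal C) : z ∈ C := by
  obtain ⟨c, hc, hzc⟩ := hz
  exact hconv.out hy hc ⟨hyz, hzc⟩

/-- The upper copy of `L[C]` is closed under going up in `L`. -/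
theorem mem_doublingSet_true_of_le (hconv : C.OrdConnected) {y z : α}
    (hy : (y, true) ∈ doublingSet C) (hyz : y ≤ z) : (z, true) ∈ doublingSet C := by
  rw [mem_doublingSet_true_s8] at hy ⊢
  intro hz
  exact mem_of_le_of_mem_lowerIdeal hconv (hy (mem_lowerIdeal_of_le hz hyz)) hyz hz

theorem coe_map_sup_eq (e : M ≃o Doubling C) {v w : M} {p : α × Bool} (hp : p ∈ doublingSet C)
    (hv : (e v).val ≤ p) (hw : (e w).val ≤ p)
    (hle : ∀ q ∈ doublingSet C, (e v).val ≤ q → (e w).val ≤ q → p ≤ q) :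
    (e (v ⊔ w)).val = p := by
  apply le_antisymm
  · have h : v ⊔ w ≤ e.symm ⟨p, hp⟩ :=
      sup_le ((e.le_symm_apply).2 hv) ((e.le_symm_apply).2 hw)
    exact (e.le_symm_apply).1 h
  · exact hle _ (e (v ⊔ w)).2 (e.monotone le_sup_left) (e.monotone le_sup_right)

theorem coe_map_inf_eq (e : M ≃o Doubling C) {v w : M} {p : α × Bool} (hp : p ∈ doublingSet C)
    (hv : p ≤ (e v).val) (hw : p ≤ (e w).val)
    (hle : ∀ q ∈ doublingSet C, q ≤ (e v).val → q ≤ (e w).val → q ≤ p) :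
    (e (v ⊓ w)).val = p := by
  apply le_antisymm
  · exact hle _ (e (v ⊓ w)).2 (e.monotone inf_le_left) (e.monotone inf_le_right)
  · have h : e.symm ⟨p, hp⟩ ≤ v ⊓ w :=
      le_inf ((e.symm_apply_le).2 hv) ((e.symm_apply_le).2 hw)
    exact (e.symm_apply_le).1 h

open Classical in
/-- Joins in `L[C]`. -/
theorem coe_map_sup (hconv : C.OrdConnected) (e : M ≃o Doubling C) (v w : M) :
    (e (v ⊔ w)).val = ((e v).val.1 ⊔ (e w).val.1,
      decide ((e v).val.2 = true ∨ (e w).val.2 = true ∨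
        (e v).val.1 ⊔ (e w).val.1 ∉ lowerIdeal C)) := by
  have hv := (e v).2
  have hw := (e w).2
  apply coe_map_sup_eq
  · rcases hev : (e v).val with ⟨y, s⟩
    rcases hew : (e w).val with ⟨z, t⟩
    rw [hev] at hv
    rw [hew] at hw
    by_cases h : s = true ∨ t = true ∨ y ⊔ z ∉ lowerIdeal C
    · simp only [h, decide_true]
      rcases h with rfl | rfl | h
      · exact mem_doublingSet_true_of_le hconv hv le_sup_left
      · exact mem_doublingSet_true_of_le hconv hw le_sup_right
      · exact mem_doublingSet_true_s8.2 fun h' => absurd h' h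
    · simp only [h, decide_false]
      push Not at h
      exact mem_doublingSet_false_s8.2 h.2.2
  · exact ⟨le_sup_left, Bool.le_iff_imp.2 fun h => by simp [h]⟩
  · exact ⟨le_sup_right, Bool.le_iff_imp.2 fun h => by simp [h]⟩
  · rintro ⟨z, t⟩ hq h1 h2
    refine ⟨sup_le h1.1 h2.1, Bool.le_iff_imp.2 fun h => ?_⟩
    rcases of_decide_eq_true h with h | h | h
    · exact Bool.le_iff_imp.1 h1.2 h
    · exact Bool.le_iff_imp.1 h2.2 h
    · cases t
      · exact absurd (mem_lowerIdeal_of_le (mem_doublingSet_false_s8.1 hq) (sup_le h1.1 h2.1)) h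
      · rfl

open Classical in
/-- Meets in `L[C]`. -/
theorem coe_map_inf (hconv : C.OrdConnected) (e : M ≃o Doubling C) (v w : M) :
    (e (v ⊓ w)).val = ((e v).val.1 ⊓ (e w).val.1,
      decide ((e v).val.2 = true ∧ (e w).val.2 = true ∧
        ((e v).val.1 ⊓ (e w).val.1, true) ∈ doublingSet C)) := by
  have hv := (e v).2
  have hw := (e w).2
  apply coe_map_inf_eq
  · rcases hev : (e v).val with ⟨y, s⟩
    rcases hew : (e w).val with ⟨z, t⟩
    rw [hev] at hv
    rw [hew] at hw
    by_cases h : s = true ∧ t = true ∧ (y ⊓ z, true) ∈ doublingSet C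
    · simp only [h, and_self, decide_true]
    · simp only [h, decide_false]
      rw [mem_doublingSet_false_s8]
      cases s
      · exact mem_lowerIdeal_of_le (mem_doublingSet_false_s8.1 hv) inf_le_left
      cases t
      · exact mem_lowerIdeal_of_le (mem_doublingSet_false_s8.1 hw) inf_le_right
      by_contra h'
      exact h ⟨rfl, rfl, mem_doublingSet_true_s8.2 fun h'' => absurd h'' h'⟩
  · exact ⟨inf_le_left, Bool.le_iff_imp.2 fun h => (of_decide_eq_true h).1⟩
  · exact ⟨inf_le_right, Bool.le_iff_imp.2 fun h => (of_decide_eq_true h).2.1⟩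
  · rintro ⟨z, t⟩ hq h1 h2
    refine ⟨le_inf h1.1 h2.1, Bool.le_iff_imp.2 fun h => decide_eq_true ?_⟩
    obtain rfl : t = true := h
    exact ⟨Bool.le_iff_imp.1 h1.2 rfl, Bool.le_iff_imp.1 h2.2 rfl,
      mem_doublingSet_true_of_le hconv hq (le_inf h1.1 h2.1)⟩

theorem LeftModular.sup_inf_eq_of_le {a b c : α} (ha : LeftModular a) (hbc : b ≤ c) :
    (b ⊔ a) ⊓ c = b ⊔ (a ⊓ c) := by
  rcases hbc.eq_or_lt with rfl | h
  · rw [inf_eq_right.2 le_sup_left, sup_eq_left.2 inf_le_right]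
  · exact ha b c h

theorem exists_minimal_mem_le [Finite α] {m : α} (hm : m ∈ C) :
    ∃ k ≤ m, Minimal (· ∈ C) k :=
  (Set.toFinite C).exists_le_minimal hm

theorem exists_maximal_mem_ge [Finite α] {m : α} (hm : m ∈ C) :
    ∃ k, m ≤ k ∧ Maximal (· ∈ C) k :=
  (Set.toFinite C).exists_le_maximal hm

/-- An element of `L[C]` lying over a left modular element is left modular if it lies in the lower
copy below an element of the heart, or in the upper copy above an element of the heart. -/
theorem leftModular_of_heart [Finite α] (hconv : C.OrdConnected) (e : M ≃o Doubling C)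
    {h : α} (hh : h ∈ heart C) {w : M} (hw : LeftModular (e w).val.1)
    (hpos : ((e w).val.2 = false ∧ (e w).val.1 ≤ h) ∨ ((e w).val.2 = true ∧ h ≤ (e w).val.1)) :
    LeftModular w := by
  intro b c hbc
  have hle : (e b).val.1 ≤ (e c).val.1 := (e.monotone hbc.le).1
  have hfst := hw.sup_inf_eq_of_le hle
  refine le_antisymm (e.le_iff_le.1 (show (e _).val ≤ (e _).val from ?_))
    (sup_le (le_inf le_sup_left hbc.le) (inf_le_inf_right _ le_sup_right))
  simp only [coe_map_sup hconv, coe_map_inf hconv]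
  refine ⟨hfst.le, Bool.le_iff_imp.2 fun H => ?_⟩
  simp only [decide_eq_true_eq, coe_map_sup hconv, coe_map_inf hconv] at H ⊢
  obtain ⟨hsup, hc, hmem⟩ := H
  by_cases hI : (e b).val.1 ⊔ ((e w).val.1 ⊓ (e c).val.1) ∈ lowerIdeal C
  swap
  · exact Or.inr (Or.inr hI)
  rw [hfst] at hmem
  have hmC := mem_doublingSet_true_s8.1 hmem hI
  rcases hsup with hsup | hsup
  · exact Or.inl hsup
  right; left
  rcases hpos with ⟨hw0, hwh⟩ | ⟨hw1, hwh⟩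
  · rcases hsup with hsup | hsup
    · simp [hw0] at hsup
    · obtain ⟨k, hk, hkmax⟩ := exists_maximal_mem_ge hmC
      exact absurd ⟨k, hkmax.prop, sup_le (le_sup_left.trans hk)
        (hwh.trans (hh.2.1 k hkmax))⟩ hsup
  · refine ⟨hw1, hc, mem_doublingSet_true_s8.2 fun _ => ?_⟩
    obtain ⟨k, hk, hkmin⟩ := exists_minimal_mem_le hmC
    exact hconv.out hkmin.prop hmC
      ⟨le_inf ((hh.2.2 k hkmin).trans hwh) (hk.trans (sup_le hle inf_le_right)), le_sup_right⟩

/-- Splitting a maximal chain of `L` at an element of `C` gives a maximal chain of `L[C]`. -/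
theorem isMaxChain_doubling (hconv : C.OrdConnected) (e : M ≃o Doubling C) {ι : Type*}
    [LinearOrder ι] {x : ι → α} (hx : Monotone x) (hmax : IsMaxChain (· ≤ ·) (Set.range x))
    {l : ι} (hl : x l ∈ C) :
    IsMaxChain (· ≤ ·)
      {w : M | (∃ i, i ≤ l ∧ (e w).val = (x i, false)) ∨
               (∃ i, l ≤ i ∧ (e w).val = (x i, true))} := by
  have hlow : ∀ i ≤ l, (x i, false) ∈ doublingSet C := fun i hi =>
    mem_doublingSet_false_s8.2 ⟨x l, hl, hx hi⟩
  have hupp : ∀ i, l ≤ i → (x i, true) ∈ doublingSet C := fun i hi =>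
    mem_doublingSet_true_of_le hconv (mem_doublingSet_true_s8.2 fun _ => hl) (hx hi)
  have key : ∀ v w : M, (e v).val ≤ (e w).val → v ≤ w := fun v w h => e.le_iff_le.1 h
  refine ⟨?_, fun t ht hst => hst.antisymm fun w hw => ?_⟩
  · rintro v (⟨i, hi, hv⟩ | ⟨i, hi, hv⟩) w (⟨j, hj, hw⟩ | ⟨j, hj, hw⟩) -
    · rcases le_total i j with h | h
      · exact Or.inl (key _ _ (by rw [hv, hw]; exact ⟨hx h, le_rfl⟩))
      · exact Or.inr (key _ _ (by rw [hv, hw]; exact ⟨hx h, le_rfl⟩))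
    · exact Or.inl (key _ _ (by rw [hv, hw]; exact ⟨hx (hi.trans hj), bot_le⟩))
    · exact Or.inr (key _ _ (by rw [hv, hw]; exact ⟨hx (hj.trans hi), bot_le⟩))
    · rcases le_total i j with h | h
      · exact Or.inl (key _ _ (by rw [hv, hw]; exact ⟨hx h, le_rfl⟩))
      · exact Or.inr (key _ _ (by rw [hv, hw]; exact ⟨hx h, le_rfl⟩))
  · have hcomp : ∀ p (hp : p ∈ doublingSet C),
        ((∃ i, i ≤ l ∧ p = (x i, false)) ∨ (∃ i, l ≤ i ∧ p = (x i, true))) →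
        (e w).val ≤ p ∨ p ≤ (e w).val := by
      intro p hp h
      have hpt : e.symm ⟨p, hp⟩ ∈ t := hst (by simpa using h)
      rcases ht.total hw hpt with h' | h'
      · exact Or.inl ((e.le_symm_apply).1 h')
      · exact Or.inr ((e.symm_apply_le).1 h')
    have hfalse := fun i (hi : i ≤ l) => hcomp _ (hlow i hi) (Or.inl ⟨i, hi, rfl⟩)
    have htrue := fun i (hi : l ≤ i) => hcomp _ (hupp i hi) (Or.inr ⟨i, hi, rfl⟩)
    have hrange : (e w).val.1 ∈ Set.range x := by
      have hchain : IsChain (· ≤ ·) (insert (e w).val.1 (Set.range x)) := by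
        refine hmax.1.insert ?_
        rintro _ ⟨i, rfl⟩ -
        rcases le_total i l with hi | hi
        · exact (hfalse i hi).imp And.left And.left
        · exact (htrue i hi).imp And.left And.left
      rw [hmax.2 hchain (Set.subset_insert _ _)]
      exact Set.mem_insert _ _
    obtain ⟨j, hj⟩ := hrange
    change (∃ i, i ≤ l ∧ (e w).val = (x i, false)) ∨ (∃ i, l ≤ i ∧ (e w).val = (x i, true))
    rcases hew : (e w).val with ⟨y, s⟩
    rw [hew] at hfalse htrue hj
    obtain rfl : x j = y := hj
    cases s
    · rcases le_total j l with h | h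
      · exact Or.inl ⟨j, h, rfl⟩
      · rcases htrue l le_rfl with h' | h'
        · exact Or.inl ⟨l, le_rfl, Prod.ext (h'.1.antisymm (hx h)) rfl⟩
        · exact absurd (Bool.le_iff_imp.1 h'.2 rfl) Bool.false_ne_true
    · rcases le_total j l with h | h
      · rcases hfalse l le_rfl with h' | h'
        · exact absurd (Bool.le_iff_imp.1 h'.2 rfl) Bool.false_ne_true
        · exact Or.inr ⟨l, le_rfl, Prod.ext ((hx h).antisymm h'.1) rfl⟩
      · exact Or.inr ⟨j, h, rfl⟩

end DoublingLattice

/-- If some `a = x l ∈ H(C)` lies on a maximal chain `x_0 ⋖ ⋯ ⋖ x_n` of `L` made of left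
modular elements, then the chain
`(x_0,0) ⋖ ⋯ ⋖ (x_{l-1},0) ⋖ (a,0) ⋖ (a,1) ⋖ (x_{l+1},1) ⋖ ⋯ ⋖ (x_n,1)`
of the doubling `L[C]` (realized as any lattice `M` order-isomorphic to it) is a maximal
chain consisting of left modular elements; in particular `L[C]` is left modular. -/
theorem doubling_leftModular_chain (α : Type u) [Lattice α] [Fintype α] [Nonempty α]
    (C : Set α) (hne : C.Nonempty) (hconv : C.OrdConnected)
    (n : ℕ) (x : Fin (n + 1) → α)
    (hcov : ∀ i : Fin n, x i.castSucc ⋖ x i.succ)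
    (hmax : IsMaxChain (· ≤ ·) (Set.range x))
    (hlm : ∀ i : Fin (n + 1), LeftModular (x i))
    (l : Fin (n + 1)) (hheart : x l ∈ heart C)
    (M : Type v) [Lattice M] (e : M ≃o Doubling C) :
    (IsMaxChain (· ≤ ·)
      {w : M | (∃ i : Fin (n + 1), i ≤ l ∧ (e w).val = (x i, false)) ∨
               (∃ i : Fin (n + 1), l ≤ i ∧ (e w).val = (x i, true))} ∧
      (∀ w : M,
        ((∃ i : Fin (n + 1), i ≤ l ∧ (e w).val = (x i, false)) ∨
         (∃ i : Fin (n + 1), l ≤ i ∧ (e w).val = (x i, true))) →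
        LeftModular w)) ∧
    IsLeftModularLattice M := by
  have hmono : Monotone x := (Fin.strictMono_iff_lt_succ.2 fun i => (hcov i).lt).monotone
  have hchain := isMaxChain_doubling hconv e hmono hmax hheart.1
  refine ⟨⟨hchain, ?main⟩, _, hchain, ?main⟩
  rintro w (⟨i, hi, hw⟩ | ⟨i, hi, hw⟩)
  · refine leftModular_of_heart hconv e hheart ?_ (Or.inl ?_)
    · rw [hw]
      exact hlm i
    · rw [hw]
      exact ⟨rfl, hmono hi⟩
  · refine leftModular_of_heart hconv e hheart ?_ (Or.inr ?_)
    · rw [hw]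
      exact hlm i
    · rw [hw]
      exact ⟨rfl, hmono hi⟩
end

section
/- Let L be an extremal congruence uniform lattice. Then every element of the spine of L is a left modular element of L. -/
universe u

/-- A finite lattice is extremal if `ℓ(L) = |JIrr(L)| = |MIrr(L)|`. -/
noncomputable def IsExtremal (β : Type u) [Lattice β] : Prop :=
  latLen β = {j : β | IsJoinIrred j}.ncard ∧ latLen β = {m : β | IsMeetIrred m}.ncard

/-- `γ` is (isomorphic to) the doubling of the lattice `β` by a nonempty interval. -/
def IsDoublingOfInterval (γ β : Type u) [iγ : Lattice γ] [iβ : Lattice β] : Prop :=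
  ∃ a b : β, a ≤ b ∧ Nonempty (γ ≃o Doubling (Set.Icc a b))

/-- `γ` is order-isomorphic to `β`. -/
def LatOrderIso (γ β : Type u) [iγ : Lattice γ] [iβ : Lattice β] : Prop :=
  Nonempty (γ ≃o β)

/-- A finite lattice is congruence uniform if it is obtained from the one-element lattice
by a finite sequence of doublings of nonempty intervals. -/
def IsCongruenceUniform (β : Type u) [Lattice β] : Prop :=
  ∃ (n : ℕ) (K : Fin (n + 1) → Type u) (instK : ∀ i, Lattice (K i)),
    (Subsingleton (K 0) ∧ Nonempty (K 0)) ∧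
    (∀ i : Fin n, IsDoublingOfInterval (K i.succ) (K i.castSucc)
      (iγ := instK i.succ) (iβ := instK i.castSucc)) ∧
    LatOrderIso β (K (Fin.last n)) (iβ := instK (Fin.last n))

/-- An element with a greatest element strictly below it is join-irreducible. -/
theorem isJoinIrred_of_isGreatest {α : Type u} [Lattice α] {j c : α}
    (h : IsGreatest (Set.Iio j) c) : IsJoinIrred j := by
  have hc : c < j := h.1
  refine ⟨c, ⟨hc, fun x hcx hxj => (h.2 hxj).not_gt hcx⟩, fun y hy => ?_⟩
  by_contra hne
  exact hy.2 (lt_of_le_of_ne (h.2 hy.lt) hne) hc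

theorem mem_doublingSet_Icc {β : Type u} [Lattice β] {a b : β} (hab : a ≤ b) (p : β × Bool) :
    p ∈ doublingSet (Set.Icc a b) ↔
      (p.2 = false ∧ p.1 ≤ b) ∨ (p.2 = true ∧ (p.1 ≤ b → a ≤ p.1)) := by
  have h : ∀ y : β, y ∈ lowerIdeal (Set.Icc a b) ↔ y ≤ b := fun y =>
    ⟨fun ⟨x, hx, hyx⟩ => hyx.trans hx.2, fun hy => ⟨b, ⟨hab, le_rfl⟩, hy⟩⟩
  simp only [doublingSet, Set.mem_ofPred_eq, h, Set.mem_Icc]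
  tauto

/-- `f` identifies `γ` with the doubling of `β` by the interval `[a, b]`. -/
structure IsDoublingMap {γ β : Type u} [Lattice γ] [Lattice β] (a b : β)
    (f : γ → β × Bool) : Prop where
  le_iff : ∀ x y, f x ≤ f y ↔ x ≤ y
  mem_range : ∀ p, p ∈ Set.range f ↔
    (p.2 = false ∧ p.1 ≤ b) ∨ (p.2 = true ∧ (p.1 ≤ b → a ≤ p.1))

theorem IsDoublingOfInterval.exists_isDoublingMap {γ β : Type u} [Lattice γ] [Lattice β]
    (h : IsDoublingOfInterval γ β) :
    ∃ a b : β, a ≤ b ∧ ∃ f : γ → β × Bool, IsDoublingMap a b f := by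
  obtain ⟨a, b, hab, ⟨e⟩⟩ := h
  refine ⟨a, b, hab, fun x => (e x).1, fun x y => e.le_iff_le, fun p => ?_⟩
  rw [← mem_doublingSet_Icc hab]
  constructor
  · rintro ⟨x, rfl⟩
    exact (e x).2
  · intro hp
    exact ⟨e.symm ⟨p, hp⟩, by simp⟩

namespace IsDoublingMap

variable {γ β : Type u} [Lattice γ] [Lattice β] {a b : β} {f : γ → β × Bool}

theorem injective (hf : IsDoublingMap a b f) : Function.Injective f := fun x y h =>
  le_antisymm ((hf.le_iff x y).1 h.le) ((hf.le_iff y x).1 h.ge)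

theorem fst_mono (hf : IsDoublingMap a b f) {x y : γ} (h : x ≤ y) : (f x).1 ≤ (f y).1 :=
  ((hf.le_iff x y).2 h).1

theorem snd_mono (hf : IsDoublingMap a b f) {x y : γ} (h : x ≤ y) (hx : (f x).2 = true) :
    (f y).2 = true := by
  have := ((hf.le_iff x y).2 h).2
  rw [hx] at this
  exact top_le_iff.1 this

theorem le_of_fst_le (hf : IsDoublingMap a b f) {x y : γ} (h₁ : (f x).1 ≤ (f y).1)
    (h₂ : (f x).2 = true → (f y).2 = true) : x ≤ y :=
  (hf.le_iff x y).1 ⟨h₁, by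
    cases hx : (f x).2
    · exact Bool.false_le _
    · rw [h₂ hx]⟩

theorem fst_le (hf : IsDoublingMap a b f) {x : γ} (h : (f x).2 = false) : (f x).1 ≤ b := by
  have := (hf.mem_range (f x)).1 ⟨x, rfl⟩
  simp_all

theorem le_fst (hf : IsDoublingMap a b f) {x : γ} (h : (f x).2 = true) (hb : (f x).1 ≤ b) :
    a ≤ (f x).1 := by
  have := (hf.mem_range (f x)).1 ⟨x, rfl⟩
  simp_all

theorem exists_false (hf : IsDoublingMap a b f) {z : β} (h : z ≤ b) : ∃ x, f x = (z, false) :=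
  (hf.mem_range _).2 (by simp [h])

theorem exists_true (hf : IsDoublingMap a b f) {z : β} (h : z ≤ b → a ≤ z) :
    ∃ x, f x = (z, true) :=
  (hf.mem_range _).2 (Or.inr ⟨rfl, h⟩)

theorem fst_sup (hf : IsDoublingMap a b f) (x y : γ) : (f (x ⊔ y)).1 = (f x).1 ⊔ (f y).1 := by
  refine le_antisymm ?_ (sup_le (hf.fst_mono le_sup_left) (hf.fst_mono le_sup_right))
  suffices h : ∃ w, (f w).1 = (f x).1 ⊔ (f y).1 ∧
      ((f x).2 = true → (f w).2 = true) ∧ ((f y).2 = true → (f w).2 = true) by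
    obtain ⟨w, hw, hx, hy⟩ := h
    rw [← hw]
    exact hf.fst_mono (sup_le (hf.le_of_fst_le (hw ▸ le_sup_left) hx)
      (hf.le_of_fst_le (hw ▸ le_sup_right) hy))
  by_cases hb : (f x).1 ⊔ (f y).1 ≤ b → a ≤ (f x).1 ⊔ (f y).1
  · obtain ⟨w, hw⟩ := hf.exists_true hb
    exact ⟨w, by simp [hw]⟩
  · rw [Classical.not_imp] at hb
    obtain ⟨hb, ha⟩ := hb
    obtain ⟨w, hw⟩ := hf.exists_false hb
    refine ⟨w, by simp [hw], fun hx => (ha ?_).elim, fun hy => (ha ?_).elim⟩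
    · exact (hf.le_fst hx (le_sup_left.trans hb)).trans le_sup_left
    · exact (hf.le_fst hy (le_sup_right.trans hb)).trans le_sup_right

theorem fst_inf (hf : IsDoublingMap a b f) (x y : γ) : (f (x ⊓ y)).1 = (f x).1 ⊓ (f y).1 := by
  refine le_antisymm (le_inf (hf.fst_mono inf_le_left) (hf.fst_mono inf_le_right)) ?_
  suffices h : ∃ w, (f w).1 = (f x).1 ⊓ (f y).1 ∧
      ((f w).2 = true → (f x).2 = true) ∧ ((f w).2 = true → (f y).2 = true) by
    obtain ⟨w, hw, hx, hy⟩ := h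
    rw [← hw]
    exact hf.fst_mono (le_inf (hf.le_of_fst_le (hw ▸ inf_le_left) hx)
      (hf.le_of_fst_le (hw ▸ inf_le_right) hy))
  by_cases hb : (f x).1 ⊓ (f y).1 ≤ b
  · obtain ⟨w, hw⟩ := hf.exists_false hb
    exact ⟨w, by simp [hw]⟩
  · obtain ⟨w, hw⟩ := hf.exists_true (fun h => (hb h).elim)
    refine ⟨w, by simp [hw], fun _ => ?_, fun _ => ?_⟩
    · by_contra hx
      exact hb (inf_le_left.trans (hf.fst_le (by simpa using hx)))
    · by_contra hy
      exact hb (inf_le_right.trans (hf.fst_le (by simpa using hy)))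

theorem snd_sup_eq_false (hf : IsDoublingMap a b f) {x y : γ} (hx : (f x).2 = false)
    (hy : (f y).2 = false) : (f (x ⊔ y)).2 = false := by
  obtain ⟨w, hw⟩ := hf.exists_false (sup_le (hf.fst_le hx) (hf.fst_le hy))
  have hle : x ⊔ y ≤ w := sup_le (hf.le_of_fst_le (by simp [hw]) (by simp [hx]))
    (hf.le_of_fst_le (by simp [hw]) (by simp [hy]))
  by_contra h
  have := hf.snd_mono hle (by simpa using h)
  simp [hw] at this

theorem snd_inf_eq_true (hf : IsDoublingMap a b f) {x y : γ} (hx : (f x).2 = true)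
    (hy : (f y).2 = true) (hax : a ≤ (f x).1) (hay : a ≤ (f y).1) : (f (x ⊓ y)).2 = true := by
  obtain ⟨w, hw⟩ := hf.exists_true (z := (f x).1 ⊓ (f y).1) (fun _ => le_inf hax hay)
  have hle : w ≤ x ⊓ y := le_inf (hf.le_of_fst_le (by simp [hw]) (by simp [hx]))
    (hf.le_of_fst_le (by simp [hw]) (by simp [hy]))
  exact hf.snd_mono hle (by simp [hw])

theorem leftModular (hf : IsDoublingMap a b f) {x : γ} (hx : LeftModular (f x).1)
    (hax : (f x).2 = true → a ≤ (f x).1) : LeftModular x := by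
  intro y z hyz
  have hle : y ⊔ (x ⊓ z) ≤ (y ⊔ x) ⊓ z :=
    le_inf (sup_le_sup_left inf_le_left y) (sup_le hyz.le inf_le_right)
  have hfst : (f ((y ⊔ x) ⊓ z)).1 = (f (y ⊔ (x ⊓ z))).1 := by
    simp only [hf.fst_inf, hf.fst_sup]
    rcases (hf.fst_mono hyz.le).lt_or_eq with h | h
    · exact hx _ _ h
    · rw [h, inf_eq_right.2 le_sup_left, sup_eq_left.2 inf_le_right]
  refine le_antisymm (hf.le_of_fst_le hfst.le fun hl => ?_) hle
  by_contra hr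
  have hr : (f (y ⊔ (x ⊓ z))).2 = false := by simpa using hr
  have hz := hf.snd_mono inf_le_right hl
  have hyx := hf.snd_mono inf_le_left hl
  have hy : (f y).2 = false := by
    by_contra h
    simp [hf.snd_mono le_sup_left (by simpa using h)] at hr
  have hxt : (f x).2 = true := by
    by_contra h
    simp [hf.snd_sup_eq_false hy (by simpa using h)] at hyx
  have haz : a ≤ (f z).1 :=
    (hf.le_fst hl (hfst ▸ hf.fst_le hr)).trans (hf.fst_mono inf_le_right)
  have := hf.snd_mono (y := y ⊔ (x ⊓ z)) le_sup_right
    (hf.snd_inf_eq_true hxt hz (hax hxt) haz)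
  simp [hr] at this

/-- The least preimage of an element with a greatest element strictly below it again has one. -/
theorem exists_isGreatest_Iio (hf : IsDoublingMap a b f) {j : β}
    (hj : ∃ c, IsGreatest (Set.Iio j) c) :
    ∃ x, (f x).1 = j ∧ (j ≤ b → (f x).2 = false) ∧ ∃ c, IsGreatest (Set.Iio x) c := by
  obtain ⟨c, hc, hmax⟩ := hj
  have hcj : c < j := hc
  by_cases hb : j ≤ b
  · obtain ⟨x, hx⟩ := hf.exists_false hb
    obtain ⟨w, hw⟩ := hf.exists_false (hcj.le.trans hb)
    have hwx : w ≤ x := hf.le_of_fst_le (by simp [hw, hx, hcj.le]) (by simp [hw])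
    refine ⟨x, by simp [hx], by simp [hx], w,
      lt_of_le_of_ne hwx fun h => by subst h; simp [hw] at hx; exact hcj.ne hx, fun y hy => ?_⟩
    have hyx : y < x := hy
    have hy2 : (f y).2 = false := by
      by_contra h
      have := hf.snd_mono hyx.le (by simpa using h)
      simp [hx] at this
    refine hf.le_of_fst_le ?_ (by simp [hy2])
    rw [hw]
    refine hmax (lt_of_le_of_ne (by simpa [hx] using hf.fst_mono hyx.le) fun h => hyx.ne ?_)
    exact hf.injective (by rw [hx]; exact Prod.ext h hy2)
  · obtain ⟨x, hx⟩ := hf.exists_true (fun h => (hb h).elim)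
    have hlt : ∀ y, y < x → (f y).1 ≤ c := fun y hyx => by
      refine hmax (lt_of_le_of_ne (by simpa [hx] using hf.fst_mono hyx.le) fun h => hyx.ne ?_)
      rw [← hf.injective.eq_iff, hx]
      refine Prod.ext h ?_
      by_contra hy2
      exact hb (h ▸ hf.fst_le (by simpa using hy2))
    have hx1 : (f x).1 = j := by simp [hx]
    refine ⟨x, hx1, fun h => (hb h).elim, ?_⟩
    suffices h : ∃ w, (f w).1 = c ∧ ∀ y, y < x → (f y).2 = true → (f w).2 = true by
      obtain ⟨w, hw, hw2⟩ := h
      refine ⟨w, lt_of_le_of_ne (hf.le_of_fst_le (by rw [hw, hx1]; exact hcj.le) (by simp [hx]))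
        fun h => hcj.ne (by rw [← hw, h, hx1]), fun y hy => ?_⟩
      exact hf.le_of_fst_le (hw ▸ hlt y hy) (hw2 y hy)
    by_cases hca : c ≤ b → a ≤ c
    · obtain ⟨w, hw⟩ := hf.exists_true hca
      exact ⟨w, by simp [hw]⟩
    · rw [Classical.not_imp] at hca
      obtain ⟨w, hw⟩ := hf.exists_false hca.1
      refine ⟨w, by simp [hw], fun y hy hy2 => (hca.2 ?_).elim⟩
      exact (hf.le_fst hy2 ((hlt y hy).trans hca.1)).trans (hlt y hy)

/-- The doubling creates a new join-irreducible element, the upper copy of `a`. -/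
theorem exists_new_isGreatest_Iio (hf : IsDoublingMap a b f) (hab : a ≤ b) :
    ∃ x, f x = (a, true) ∧ ∃ c, IsGreatest (Set.Iio x) c := by
  obtain ⟨x, hx⟩ := hf.exists_true (fun _ => le_refl a)
  obtain ⟨w, hw⟩ := hf.exists_false hab
  refine ⟨x, hx, w, lt_of_le_of_ne (hf.le_of_fst_le (by simp [hw, hx]) (by simp [hx]))
    fun h => by subst h; simp [hw] at hx, fun y hy => ?_⟩
  have hyx : y < x := hy
  have h1 : (f y).1 ≤ a := by simpa [hx] using hf.fst_mono hyx.le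
  refine hf.le_of_fst_le (by simpa [hw] using h1) fun hy2 => (hyx.ne ?_).elim
  exact hf.injective (by rw [hx]; exact Prod.ext (h1.antisymm (hf.le_fst hy2 (h1.trans hab))) hy2)

/-- A chain in the doubling projects to a chain with at most one element fewer; if it has
one element fewer, then the chain contains both copies of some element. -/
theorem exists_chain_image (hf : IsDoublingMap a b f) {s : Finset γ}
    (hs : IsChain (· ≤ ·) (s : Set γ)) :
    ∃ t : Finset β, IsChain (· ≤ ·) (t : Set β) ∧ (∀ x ∈ s, (f x).1 ∈ t) ∧
      (s.card ≤ t.card ∨ (s.card = t.card + 1 ∧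
        ∃ x ∈ s, ∃ y ∈ s, (f x).2 = false ∧ (f y).2 = true ∧ (f x).1 = (f y).1)) := by
  classical
  have hcard : ∀ e : Bool, ((s.filter fun x => (f x).2 = e).image fun x => (f x).1).card =
      (s.filter fun x => (f x).2 = e).card := fun e => by
    refine Finset.card_image_of_injOn fun x hx y hy hxy => hf.injective (Prod.ext hxy ?_)
    simp only [Finset.coe_filter, Set.mem_ofPred_eq] at hx hy
    rw [hx.2, hy.2]
  set A := (s.filter fun x => (f x).2 = false).image fun x => (f x).1 with hA
  set B := (s.filter fun x => (f x).2 = true).image fun x => (f x).1 with hB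
  have hle : ∀ q ∈ A, ∀ p ∈ B, q ≤ p := by
    intro q hq p hp
    simp only [hA, hB, Finset.mem_image, Finset.mem_filter] at hp hq
    obtain ⟨x, ⟨hxs, hx⟩, rfl⟩ := hp
    obtain ⟨y, ⟨hys, hy⟩, rfl⟩ := hq
    rcases hs.total hxs hys with h | h
    · simp [hf.snd_mono h hx] at hy
    · exact hf.fst_mono h
  have hAB : (A ∩ B).card ≤ 1 := Finset.card_le_one.2 fun p hp q hq => by
    rw [Finset.mem_inter] at hp hq
    exact (hle p hp.1 q hq.2).antisymm (hle q hq.1 p hp.2)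
  have hsum : s.card = (A ∪ B).card + (A ∩ B).card := by
    rw [Finset.card_union_add_card_inter, hcard, hcard,
      ← Finset.card_filter_add_card_filter_not (s := s) fun x => (f x).2 = false]
    simp
  have hmem : ∀ p, p ∈ A ∪ B ↔ ∃ x ∈ s, (f x).1 = p := by
    intro p
    simp only [hA, hB, Finset.mem_union, Finset.mem_image, Finset.mem_filter]
    constructor
    · rintro (⟨x, ⟨hx, _⟩, h⟩ | ⟨x, ⟨hx, _⟩, h⟩) <;> exact ⟨x, hx, h⟩
    · rintro ⟨x, hx, h⟩
      cases hx2 : (f x).2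
      · exact Or.inl ⟨x, ⟨hx, hx2⟩, h⟩
      · exact Or.inr ⟨x, ⟨hx, hx2⟩, h⟩
  refine ⟨A ∪ B, ?_, fun x hx => (hmem _).2 ⟨x, hx, rfl⟩, ?_⟩
  · intro p hp q hq _
    obtain ⟨x, hx, rfl⟩ := (hmem p).1 hp
    obtain ⟨y, hy, rfl⟩ := (hmem q).1 hq
    exact (hs.total hx hy).imp hf.fst_mono hf.fst_mono
  · rcases (A ∩ B).eq_empty_or_nonempty with h | ⟨p, hp⟩
    · left
      simp [hsum, h]
    · right
      have hpos : 0 < (A ∩ B).card := Finset.card_pos.2 ⟨p, hp⟩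
      refine ⟨by omega, ?_⟩
      simp only [hA, hB, Finset.mem_inter, Finset.mem_image, Finset.mem_filter] at hp
      obtain ⟨⟨x, ⟨hxs, hx⟩, hxp⟩, y, ⟨hys, hy⟩, hyp⟩ := hp
      exact ⟨x, hxs, y, hys, hx, hy, hxp.trans hyp.symm⟩

end IsDoublingMap

/-- The invariant of a lattice `β` obtained by `n` interval doublings: there are at least `n`
join-irreducible elements, chains have length at most `n`, and the elements of chains of
length `n` are left modular. -/
structure DoublingInvariant (β : Type u) [Lattice β] (n : ℕ) : Prop where
  exists_joinIrred : ∃ s : Finset β, s.card = n ∧ ∀ j ∈ s, ∃ c, IsGreatest (Set.Iio j) c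
  card_le : ∀ s : Finset β, IsChain (· ≤ ·) (s : Set β) → s.card ≤ n + 1
  leftModular : ∀ s : Finset β, IsChain (· ≤ ·) (s : Set β) → s.card = n + 1 →
    ∀ x ∈ s, LeftModular x

namespace DoublingInvariant

theorem of_subsingleton (β : Type u) [Lattice β] [Subsingleton β] : DoublingInvariant β 0 where
  exists_joinIrred := ⟨∅, by simp⟩
  card_le s _ := by simpa using Finset.card_le_one_of_subsingleton s
  leftModular _ _ _ _ _ _ _ _ := Subsingleton.elim _ _

theorem doubling {γ β : Type u} [Lattice γ] [Lattice β] {n : ℕ} (hβ : DoublingInvariant β n)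
    (h : IsDoublingOfInterval γ β) : DoublingInvariant γ (n + 1) := by
  classical
  obtain ⟨a, b, hab, f, hf⟩ := h.exists_isDoublingMap
  refine ⟨?_, fun s hs => ?_, fun s hs hcard x hx => ?_⟩
  · obtain ⟨s, hs, hj⟩ := hβ.exists_joinIrred
    obtain ⟨x, hx, hxj⟩ := hf.exists_new_isGreatest_Iio hab
    choose g hg1 hg2 hg3 using fun j : s => hf.exists_isGreatest_Iio (hj j.1 j.2)
    have hginj : Function.Injective g := fun i j hij => Subtype.ext (by rw [← hg1 i, hij, hg1 j])
    have hnot : x ∉ s.attach.image g := by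
      intro hmem
      obtain ⟨j, -, rfl⟩ := Finset.mem_image.1 hmem
      have h1 : a = j.1 := by rw [← hg1 j, hx]
      simpa [hx] using hg2 j (h1 ▸ hab)
    refine ⟨insert x (s.attach.image g), ?_, fun y hy => ?_⟩
    · rw [Finset.card_insert_of_notMem hnot, Finset.card_image_of_injective _ hginj,
        Finset.card_attach, hs]
    · rcases Finset.mem_insert.1 hy with rfl | hy
      · exact hxj
      · obtain ⟨j, -, rfl⟩ := Finset.mem_image.1 hy
        exact hg3 j
  · obtain ⟨t, ht, -, h⟩ := hf.exists_chain_image hs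
    have := hβ.card_le t ht
    omega
  · obtain ⟨t, ht, hst, h⟩ := hf.exists_chain_image hs
    have hle := hβ.card_le t ht
    rcases h with h | ⟨h, y, hy, z, hz, hy2, hz2, hyz⟩
    · omega
    refine hf.leftModular (hβ.leftModular t ht (by omega) _ (hst x hx)) fun hx2 => ?_
    have hzb : (f z).1 ≤ b := hyz ▸ hf.fst_le hy2
    rcases hs.total hx hz with hxz | hzx
    · exact hf.le_fst hx2 ((hf.fst_mono hxz).trans hzb)
    · exact (hf.le_fst hz2 hzb).trans (hf.fst_mono hzx)

theorem of_orderIso {γ β : Type u} [Lattice γ] [Lattice β] {n : ℕ} (hβ : DoublingInvariant β n)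
    (e : γ ≃o β) : DoublingInvariant γ n := by
  have hchain : ∀ s : Finset γ, IsChain (· ≤ ·) (s : Set γ) →
      IsChain (· ≤ ·) (s.map e.toEquiv.toEmbedding : Set β) := by
    intro s hs p hp q hq _
    simp only [Finset.coe_map, Set.mem_image] at hp hq
    obtain ⟨x, hx, rfl⟩ := hp
    obtain ⟨y, hy, rfl⟩ := hq
    exact (hs.total hx hy).imp (e.monotone ·) (e.monotone ·)
  refine ⟨?_, fun s hs => ?_, fun s hs hcard x hx y z hyz => ?_⟩
  · obtain ⟨s, hs, hj⟩ := hβ.exists_joinIrred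
    refine ⟨s.map e.symm.toEquiv.toEmbedding, by simpa using hs, fun j hjs => ?_⟩
    obtain ⟨i, hi, rfl⟩ := Finset.mem_map.1 hjs
    obtain ⟨c, hc, hmax⟩ := hj i hi
    refine ⟨e.symm c, e.symm.lt_iff_lt.2 hc, fun y hy => ?_⟩
    exact e.le_symm_apply.2 (hmax (e.lt_symm_apply.1 hy))
  · simpa using hβ.card_le _ (hchain s hs)
  · have := hβ.leftModular _ (hchain s hs) (by simpa using hcard) (e x)
      (Finset.mem_map_of_mem _ hx) (e y) (e z) (e.lt_iff_lt.2 hyz)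
    apply e.injective
    simpa using this

end DoublingInvariant

theorem IsCongruenceUniform.exists_doublingInvariant {α : Type u} [Lattice α]
    (h : IsCongruenceUniform α) : ∃ n, DoublingInvariant α n := by
  obtain ⟨n, K, instK, ⟨hsub, -⟩, hstep, ⟨e⟩⟩ := h
  have hK : ∀ i : Fin (n + 1), DoublingInvariant (K i) i := fun i => by
    induction i using Fin.induction with
    | zero => exact .of_subsingleton (K 0)
    | succ i ih => exact ih.doubling (hstep i)
  exact ⟨n, (hK (Fin.last n)).of_orderIso e⟩

/-- Every element of the spine of an extremal congruence uniform lattice is left modular. -/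
theorem spine_leftModular_of_extremal_congruenceUniform (α : Type u)
    [Lattice α] [Fintype α] [Nonempty α]
    (hcu : IsCongruenceUniform α) (hext : IsExtremal α) :
    ∀ a ∈ spine α, LeftModular a := by
  classical
  rintro x ⟨f, hf, hx⟩
  obtain ⟨n, hn⟩ := hcu.exists_doublingInvariant
  obtain ⟨s, hs, hj⟩ := hn.exists_joinIrred
  have hle : n ≤ latLen α := by
    rw [hext.1, ← hs, ← Set.ncard_coe_finset]
    exact Set.ncard_le_ncard (fun j hjs => isJoinIrred_of_isGreatest (hj j hjs).choose_spec)
  have hchain : IsChain (· ≤ ·) (Finset.univ.image f : Set α) := by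
    simpa using hf.monotone.isChain_range
  have hcard : (Finset.univ.image f).card = latLen α + 1 := by
    rw [Finset.card_image_of_injective _ hf.injective, Finset.card_univ, Fintype.card_fin]
  have := hn.card_le _ hchain
  exact hn.leftModular _ hchain (by omega) x (by simpa using hx)
end

section
/- Every join-congruence uniform left modular lattice is join-extremal: if L is obtained from the one-element lattice by a finite sequence of doublings of nonempty lower pseudo-intervals and L is left modular, then ℓ(L) = |JIrr(L)|. -/
universe u

/-- `γ` is (isomorphic to) the doubling of the lattice `β` by a nonempty lower
pseudo-interval, i.e. a union of intervals sharing the same minimum element. -/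
def IsDoublingOfLowerPseudoInterval (γ β : Type u) [iγ : Lattice γ] [iβ : Lattice β] :
    Prop :=
  ∃ C : Set β, C.Nonempty ∧
    (∃ (a : β) (T : Set β), (∀ b ∈ T, a ≤ b) ∧ C = ⋃ b ∈ T, Set.Icc a b) ∧
    Nonempty (γ ≃o Doubling C)

/-- A finite lattice is join-congruence uniform if it is obtained from the one-element
lattice by a finite sequence of doublings of nonempty lower pseudo-intervals. -/
def IsJoinCongruenceUniform (β : Type u) [Lattice β] : Prop :=
  ∃ (n : ℕ) (K : Fin (n + 1) → Type u) (instK : ∀ i, Lattice (K i)),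
    (Subsingleton (K 0) ∧ Nonempty (K 0)) ∧
    (∀ i : Fin n, IsDoublingOfLowerPseudoInterval (K i.succ) (K i.castSucc)
      (iγ := instK i.succ) (iβ := instK i.castSucc)) ∧
    LatOrderIso β (K (Fin.last n)) (iβ := instK (Fin.last n))

/-- Join-semidistributivity: `a ⊔ b = a ⊔ c` implies `a ⊔ (b ⊓ c) = a ⊔ b`. -/
def JoinSemidistributive (β : Type u) [Lattice β] : Prop :=
  ∀ a b c : β, a ⊔ b = a ⊔ c → a ⊔ (b ⊓ c) = a ⊔ b

theorem JoinSemidistributive.of_orderIso {γ β : Type u} [Lattice γ] [Lattice β]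
    (h : JoinSemidistributive β) (e : γ ≃o β) : JoinSemidistributive γ := by
  intro a b c habc
  apply e.injective
  rw [e.map_sup, e.map_sup, e.map_inf]
  apply h
  rw [← e.map_sup, ← e.map_sup, habc]

theorem mem_iUnion_Icc_iff {β : Type u} [Lattice β] {a x : β} {T : Set β} :
    x ∈ ⋃ b ∈ T, Set.Icc a b ↔ x ∈ lowerIdeal (⋃ b ∈ T, Set.Icc a b) ∧ a ≤ x := by
  simp only [lowerIdeal, Set.mem_iUnion, Set.mem_Icc, Set.mem_ofPred_eq, exists_prop]
  constructor
  · rintro ⟨b, hb, hax, hxb⟩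
    exact ⟨⟨x, ⟨b, hb, hax, hxb⟩, le_rfl⟩, hax⟩
  · rintro ⟨⟨y, ⟨b, hb, -, hyb⟩, hxy⟩, hax⟩
    exact ⟨b, hb, hax, hxy.trans hyb⟩

/-- Doubling a lower pseudo-interval preserves join-semidistributivity. -/
theorem JoinSemidistributive.doubling {γ β : Type u} [Lattice γ] [Lattice β]
    (h : JoinSemidistributive β) (hd : IsDoublingOfLowerPseudoInterval γ β) :
    JoinSemidistributive γ := by
  obtain ⟨C, -, ⟨m, T, -, hC⟩, ⟨e⟩⟩ := hd
  have hmem : ∀ x, x ∈ C ↔ x ∈ lowerIdeal C ∧ m ≤ x := by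
    intro x; rw [hC]; exact mem_iUnion_Icc_iff
  have hdown : ∀ x y, x ≤ y → y ∈ lowerIdeal C → x ∈ lowerIdeal C :=
    fun x y hxy ⟨z, hz, hyz⟩ => ⟨z, hz, hxy.trans hyz⟩
  let π : γ → β := fun g => (e g).1.1
  let σ : γ → Bool := fun g => (e g).1.2
  have hle : ∀ u v, u ≤ v ↔ π u ≤ π v ∧ σ u ≤ σ v := fun u v => by
    rw [← e.le_iff_le]; rfl
  have hfalse : ∀ u, σ u = false → π u ∈ lowerIdeal C := by
    intro u hu
    rcases (e u).2 with ⟨-, h2⟩ | ⟨h1, -⟩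
    · exact h2
    · exact absurd (hu.symm.trans h1) (by simp)
  have htrue : ∀ u, σ u = true → π u ∈ lowerIdeal C → m ≤ π u := by
    intro u hu hI
    rcases (e u).2 with ⟨h1, -⟩ | ⟨-, h2 | h2⟩
    · exact absurd (hu.symm.trans h1) (by simp)
    · exact absurd hI h2
    · exact ((hmem _).1 h2).2
  have hlow : ∀ x ∈ lowerIdeal C, ∃ u, π u = x ∧ σ u = false := fun x hx =>
    ⟨e.symm ⟨(x, false), Or.inl ⟨rfl, hx⟩⟩, by simp [π], by simp [σ]⟩
  have hhigh : ∀ x, (x ∈ lowerIdeal C → m ≤ x) → ∃ u, π u = x ∧ σ u = true := by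
    intro x hx
    refine ⟨e.symm ⟨(x, true), Or.inr ⟨rfl, ?_⟩⟩, by simp [π], by simp [σ]⟩
    by_cases hI : x ∈ lowerIdeal C
    · exact Or.inr ((hmem x).2 ⟨hI, hx hI⟩)
    · exact Or.inl hI
  have hmono : ∀ u v, u ≤ v → π u ≤ π v := fun u v huv => ((hle u v).1 huv).1
  have hsup_low : ∀ u v, σ u = false → σ v = false → π u ⊔ π v ∈ lowerIdeal C →
      π (u ⊔ v) = π u ⊔ π v ∧ σ (u ⊔ v) = false := by
    intro u v hu hv hI
    obtain ⟨w, hw, hw'⟩ := hlow _ hI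
    have := (hle (u ⊔ v) w).1 (sup_le ((hle _ _).2 ⟨by simp [hw], by simp [hu]⟩)
      ((hle _ _).2 ⟨by simp [hw], by simp [hv]⟩))
    rw [hw, hw'] at this
    exact ⟨le_antisymm this.1 (sup_le (hmono _ _ le_sup_left) (hmono _ _ le_sup_right)),
      le_bot_iff.1 this.2⟩
  have hπsup : ∀ u v, π (u ⊔ v) = π u ⊔ π v := by
    intro u v
    by_cases hlo : σ u = false ∧ σ v = false ∧ π u ⊔ π v ∈ lowerIdeal C
    · exact (hsup_low u v hlo.1 hlo.2.1 hlo.2.2).1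
    · obtain ⟨w, hw, hw'⟩ := hhigh (π u ⊔ π v) (by
        intro hI
        cases hu : σ u
        · cases hv : σ v
          · exact absurd ⟨hu, hv, hI⟩ hlo
          · exact (htrue v hv (hdown _ _ le_sup_right hI)).trans le_sup_right
        · exact (htrue u hu (hdown _ _ le_sup_left hI)).trans le_sup_left)
      have := hmono (u ⊔ v) w (sup_le
        ((hle _ _).2 ⟨by simp [hw], by simp [hw', Bool.le_true]⟩)
        ((hle _ _).2 ⟨by simp [hw], by simp [hw', Bool.le_true]⟩))
      rw [hw] at this
      exact le_antisymm this (sup_le (hmono _ _ le_sup_left) (hmono _ _ le_sup_right))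
  have hπinf : ∀ u v, π (u ⊓ v) = π u ⊓ π v := by
    intro u v
    refine le_antisymm (le_inf (hmono _ _ inf_le_left) (hmono _ _ inf_le_right)) ?_
    by_cases hI : π u ⊓ π v ∈ lowerIdeal C
    · obtain ⟨w, hw, hw'⟩ := hlow _ hI
      rw [← hw]
      exact hmono _ _ (le_inf ((hle _ _).2 ⟨by simp [hw], by simp [hw']⟩)
        ((hle _ _).2 ⟨by simp [hw], by simp [hw']⟩))
    · obtain ⟨w, hw, -⟩ := hhigh (π u ⊓ π v) (fun h' => absurd h' hI)
      have hσ : ∀ z, π u ⊓ π v ≤ π z → σ z = true := by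
        intro z hz
        cases hz' : σ z
        · exact absurd (hdown _ _ hz (hfalse z hz')) hI
        · rfl
      rw [← hw]
      exact hmono _ _ (le_inf
        ((hle _ _).2 ⟨by simp [hw], by simp [hσ u inf_le_left, Bool.le_true]⟩)
        ((hle _ _).2 ⟨by simp [hw], by simp [hσ v inf_le_right, Bool.le_true]⟩))
  intro p q r hpqr
  have hπ : π (p ⊔ (q ⊓ r)) = π (p ⊔ q) := by
    rw [hπsup, hπinf, hπsup]
    exact h _ _ _ (by rw [← hπsup, ← hπsup, hpqr])
  refine le_antisymm (sup_le_sup_left inf_le_left p) ((hle _ _).2 ⟨hπ.ge, ?_⟩)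
  cases ht : σ (p ⊔ (q ⊓ r))
  swap
  · exact Bool.le_true _
  cases hs : σ (p ⊔ q)
  · exact le_rfl
  exfalso
  have hI : π (p ⊔ q) ∈ lowerIdeal C := hπ ▸ hfalse _ ht
  have hp : σ p = false := by
    have := ((hle p _).1 (le_sup_left : p ≤ p ⊔ (q ⊓ r))).2
    rw [ht] at this
    exact le_bot_iff.1 this
  have key : ∀ v, p ⊔ v = p ⊔ q → σ v = true ∧ m ≤ π v := by
    intro v hv
    have hvI : π p ⊔ π v ∈ lowerIdeal C := by rwa [← hπsup, hv]
    cases hv' : σ v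
    · have := (hsup_low p v hp hv' hvI).2
      rw [hv, hs] at this
      exact absurd this (by simp)
    · exact ⟨rfl, htrue v hv' (hdown _ _ le_sup_right hvI)⟩
  obtain ⟨hq, hmq⟩ := key q rfl
  obtain ⟨hr, hmr⟩ := key r hpqr.symm
  obtain ⟨w, hw, hw'⟩ := hhigh (π q ⊓ π r) (fun _ => le_inf hmq hmr)
  have hwle : w ≤ p ⊔ (q ⊓ r) := le_sup_of_le_right (le_inf
    ((hle _ _).2 ⟨by simp [hw], by simp [hq, hw']⟩)
    ((hle _ _).2 ⟨by simp [hw], by simp [hr, hw']⟩))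
  have := ((hle _ _).1 hwle).2
  rw [ht, hw'] at this
  exact absurd this (by decide)

theorem IsJoinCongruenceUniform.joinSemidistributive {β : Type u} [Lattice β]
    (h : IsJoinCongruenceUniform β) : JoinSemidistributive β := by
  obtain ⟨n, K, instK, ⟨hsub, -⟩, hstep, ⟨e⟩⟩ := h
  have hK : ∀ i, @JoinSemidistributive (K i) (instK i) := by
    intro i
    induction i using Fin.induction with
    | zero => exact fun a b c _ => Subsingleton.elim _ _
    | succ i ih => exact ih.doubling (hstep i)
  exact (hK (Fin.last n)).of_orderIso e

/-- In a finite lattice, `y ≰ x` is witnessed by a join-irreducible element. -/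
theorem exists_isJoinIrred_le_not_le_s12 {α : Type u} [Lattice α] [Finite α] {x y : α}
    (h : ¬ y ≤ x) : ∃ j, IsJoinIrred j ∧ j ≤ y ∧ ¬ j ≤ x := by
  obtain ⟨j, ⟨hjy, hjx⟩, hmin⟩ :=
    wellFounded_lt.has_min {z : α | z ≤ y ∧ ¬ z ≤ x} ⟨y, le_rfl, h⟩
  have hbelow : ∀ z < j, z ≤ x := fun z hz => by
    by_contra hzx
    exact hmin z ⟨hz.le.trans hjy, hzx⟩ hz
  obtain ⟨b, -, hb⟩ := exists_le_covBy_of_lt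
    (lt_of_le_of_ne inf_le_left fun h' => hjx (inf_eq_left.1 h') : j ⊓ x < j)
  refine ⟨j, ⟨b, hb, fun c hc => ?_⟩, hjy, hjx⟩
  by_contra hne
  have hsup : c ⊔ b = j := hc.wcovBy.sup_eq hb.wcovBy hne
  exact hjx (hsup ▸ sup_le (hbelow c hc.lt) (hbelow b hb.lt))

/-- The length of a finite lattice is at most its number of join-irreducible elements. -/
theorem length_le_ncard_isJoinIrred {α : Type u} [Lattice α] [Finite α] {n : ℕ}
    {f : Fin (n + 1) → α} (hf : StrictMono f) : n ≤ {j : α | IsJoinIrred j}.ncard := by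
  have hj : ∀ i : Fin n, ∃ j, IsJoinIrred j ∧ j ≤ f i.succ ∧ ¬ j ≤ f i.castSucc :=
    fun i => exists_isJoinIrred_le_not_le_s12 (hf i.castSucc_lt_succ).not_ge
  choose g hg hg_le hg_not_le using hj
  have hne : ∀ i k : Fin n, i < k → g i ≠ g k := fun i k hik heq =>
    hg_not_le k (heq ▸ (hg_le i).trans (hf.monotone (Fin.succ_le_castSucc_iff.2 hik)))
  have hinj : Function.Injective g := fun i k heq => by
    rcases lt_trichotomy i k with hik | hik | hik
    · exact absurd heq (hne i k hik)
    · exact hik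
    · exact absurd heq.symm (hne k i hik)
  have hsub : Set.range g ⊆ {j : α | IsJoinIrred j} := Set.range_subset_iff.2 fun i => hg i
  have := Set.ncard_le_ncard hsub
  rwa [← Set.image_univ, Set.ncard_image_of_injective _ hinj, Set.ncard_univ, Nat.card_fin]
    at this

/-- In a join-semidistributive lattice, if `x` is left modular and `j` is a join-irreducible
element not below `x`, then `j` is the least element `k` with `x ⊔ k = x ⊔ j`. -/
theorem JoinSemidistributive.le_of_sup_eq {α : Type u} [Lattice α] [Finite α]
    (h : JoinSemidistributive α) {x j k : α} (hx : LeftModular x) (hj : IsJoinIrred j)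
    (hjx : ¬ j ≤ x) (hjk : x ⊔ j = x ⊔ k) : j ≤ k := by
  obtain ⟨b, hb, hbuniq⟩ := hj
  have hbelow : ∀ z < j, z ≤ b := fun z hz => by
    obtain ⟨c, hzc, hc⟩ := exists_le_covBy_of_lt hz
    exact hbuniq c hc ▸ hzc
  by_contra hle
  have h1 : j ⊓ k ≤ b := hbelow _ (lt_of_le_of_ne inf_le_left fun h' => hle (inf_eq_left.1 h'))
  have h2 : x ⊓ j ≤ b := hbelow _ (lt_of_le_of_ne inf_le_right fun h' => hjx (inf_eq_right.1 h'))
  have h3 : j ≤ b ⊔ x := calc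
    j ≤ x ⊔ j := le_sup_right
    _ = x ⊔ (j ⊓ k) := (h x j k hjk).symm
    _ ≤ b ⊔ x := sup_le le_sup_right (h1.trans le_sup_left)
  have h4 := hx b j hb.lt
  rw [inf_eq_right.2 h3, sup_eq_left.2 h2] at h4
  exact hb.lt.ne h4.symm

/-- A maximal chain of left modular elements in a finite join-semidistributive lattice has more
elements than there are join-irreducible elements. -/
theorem JoinSemidistributive.ncard_isJoinIrred_lt {α : Type u} [Lattice α] [Finite α]
    [Nonempty α] (h : JoinSemidistributive α) {s : Set α} (hs : IsMaxChain (· ≤ ·) s)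
    (hlm : ∀ a ∈ s, LeftModular a) : {j : α | IsJoinIrred j}.ncard < s.ncard := by
  have := Fintype.ofFinite α
  let := Fintype.toBoundedOrder α
  have htotal : ∀ a ∈ s, ∀ b ∈ s, a ≤ b ∨ b ≤ a := fun a ha b hb => hs.1.total ha hb
  have hleast : ∀ j : α, ∃ y ∈ s, j ≤ y ∧ ∀ z ∈ s, j ≤ z → y ≤ z := by
    intro j
    obtain ⟨y, ⟨hys, hjy⟩, hmin⟩ :=
      wellFounded_lt.has_min {z : α | z ∈ s ∧ j ≤ z} ⟨⊤, hs.top_mem, le_top⟩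
    refine ⟨y, hys, hjy, fun z hz hjz => ?_⟩
    rcases htotal y hys z hz with hyz | hzy
    · exact hyz
    · exact (eq_of_le_of_not_lt hzy (hmin z ⟨hz, hjz⟩)).ge
  choose y hys hjy hymin using hleast
  have hne : ∀ j, IsJoinIrred j → y j ≠ ⊥ := by
    rintro j ⟨b, hb, -⟩ hy
    exact not_lt_bot (lt_of_lt_of_le hb.lt (hy ▸ hjy j))
  have hinj : Set.InjOn y {j | IsJoinIrred j} := by
    intro j hj k hk hjk
    obtain ⟨x, ⟨hxs, hxy⟩, hmax⟩ := wellFounded_gt.has_min {z : α | z ∈ s ∧ z < y j}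
      ⟨⊥, hs.bot_mem, bot_lt_iff_ne_bot.2 (hne j hj)⟩
    have hxmax : ∀ z ∈ s, z < y j → z ≤ x := fun z hz hzy => by
      rcases htotal x hxs z hz with hxz | hzx
      · exact (eq_of_le_of_not_lt hxz (hmax z ⟨hz, hzy⟩)).ge
      · exact hzx
    have key : ∀ i, y i = y j → ¬ i ≤ x ∧ x ⊔ i = y j := by
      intro i hi
      have hix : ¬ i ≤ x := fun hle => absurd (hymin i x hxs hle) (hi ▸ hxy.not_ge)
      have hle : x ⊔ i ≤ y j := sup_le hxy.le (hi ▸ hjy i)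
      have hmem : x ⊔ i ∈ s := by
        have hchain : IsChain (· ≤ ·) (insert (x ⊔ i) s) := by
          refine hs.1.insert fun z hz _ => ?_
          rcases htotal (y j) (hys j) z hz with hyz | hzy
          · exact Or.inl (hle.trans hyz)
          · rcases hzy.eq_or_lt with heq | hlt
            · exact Or.inl (heq ▸ hle)
            · exact Or.inr ((hxmax z hz hlt).trans le_sup_left)
        rw [hs.2 hchain (Set.subset_insert _ _)]
        exact Set.mem_insert _ _
      exact ⟨hix, le_antisymm hle (hi ▸ hymin i _ hmem le_sup_right)⟩
    obtain ⟨hjx, hjy'⟩ := key j rfl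
    obtain ⟨hkx, hky'⟩ := key k hjk.symm
    exact le_antisymm (h.le_of_sup_eq (hlm x hxs) hj hjx (hjy'.trans hky'.symm))
      (h.le_of_sup_eq (hlm x hxs) hk hkx (hky'.trans hjy'.symm))
  rw [← hinj.ncard_image]
  refine Set.ncard_lt_ncard ⟨?_, fun hsub => ?_⟩ (Set.toFinite s)
  · rintro _ ⟨j, -, rfl⟩
    exact hys j
  · obtain ⟨j, hj, hy⟩ := hsub hs.bot_mem
    exact hne j hj hy

/-- A finite chain with `n + 1` elements is the image of a strictly monotone map. -/
theorem IsChain.exists_strictMono {α : Type u} [PartialOrder α] {s : Set α} {n : ℕ}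
    (hs : IsChain (· ≤ ·) s) (hn : s.ncard = n + 1) : ∃ f : Fin (n + 1) → α, StrictMono f := by
  classical
  have := Set.finite_of_ncard_ne_zero (by omega : s.ncard ≠ 0)
  have := this.fintype
  let : LinearOrder s := hs.linearOrder
  have hcard : Fintype.card s = n + 1 := by
    rw [← hn, ← Nat.card_coe_set_eq, Nat.card_eq_fintype_card]
  exact ⟨fun i => Fintype.orderIsoFinOfCardEq s hcard i,
    fun i k hik => (Fintype.orderIsoFinOfCardEq s hcard).strictMono hik⟩

/-- Every join-congruence uniform left modular lattice is join-extremal: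
`ℓ(L) = |JIrr(L)|`. -/
theorem joinCongruenceUniform_leftModular_joinExtremal (α : Type u)
    [Lattice α] [Fintype α] [Nonempty α]
    (hjcu : IsJoinCongruenceUniform α) (hlm : IsLeftModularLattice α) :
    latLen α = {j : α | IsJoinIrred j}.ncard := by
  obtain ⟨s, hs, hslm⟩ := hlm
  have hlt := hjcu.joinSemidistributive.ncard_isJoinIrred_lt hs hslm
  obtain ⟨m, hm⟩ := Nat.exists_eq_succ_of_ne_zero (Nat.ne_zero_of_lt hlt)
  have hbound : ∀ n ∈ {n : ℕ | ∃ f : Fin (n + 1) → α, StrictMono f},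
      n ≤ {j : α | IsJoinIrred j}.ncard := fun n ⟨_, hf⟩ => length_le_ncard_isJoinIrred hf
  have hmem : m ∈ {n : ℕ | ∃ f : Fin (n + 1) → α, StrictMono f} := hs.1.exists_strictMono hm
  exact le_antisymm (csSup_le ⟨m, hmem⟩ hbound)
    ((Nat.lt_succ_iff.1 (hm ▸ hlt)).trans (le_csSup ⟨_, hbound⟩ hmem))
end
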